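/- arXiv:0910.1995 — 12 statements merged into one kernel-verified Lean document; each statement's English description precedes it below -/
import Mathlib

section
/- For a ring R the following are equivalent: (1) R is semisimple Artinian; (2) whenever A and B are submodules of an R-module E such that A and B are each injective R-modules, the intersection A ∩ B is an injective R-module; (3) whenever A and B are submodules of an R-module E such that A and B are each ℵ₀-injective R-modules, the intersection A ∩ B is an ℵ₀-injective R-module. -/
/-- An ideal is countably generated. -/
def IdealCountablyGenerated {R : Type*} [Ring R] (I : Ideal R) : Prop :=
  ∃ s : Set R, s.Countable ∧ Ideal.span s = I

/-- `M` is an ℵ₀-injective `R`-module: every `R`-linear map from a countably generated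
ideal of `R` into `M` extends to an `R`-linear map `R → M`. -/
def Aleph0Injective (R M : Type*) [Ring R] [AddCommGroup M] [Module R M] : Prop :=
  ∀ I : Ideal R, IdealCountablyGenerated I →
    ∀ f : I →ₗ[R] M, ∃ g : R →ₗ[R] M, ∀ x : I, g (x : R) = f x

universe u

theorem Aleph0Injective.of_baer {R M : Type*} [Ring R] [AddCommGroup M] [Module R M]
    (h : Module.Baer R M) : Aleph0Injective R M := fun I _ f ↦
  (h I f).imp fun _ hg x ↦ hg x x.2

theorem Aleph0Injective.of_equiv {R M N : Type*} [Ring R] [AddCommGroup M] [Module R M]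
    [AddCommGroup N] [Module R N] (e : M ≃ₗ[R] N) (h : Aleph0Injective R M) :
    Aleph0Injective R N := fun I hI f ↦
  have ⟨g, hg⟩ := h I hI (e.symm.toLinearMap ∘ₗ f)
  ⟨e.toLinearMap ∘ₗ g, fun x ↦ by simp [hg]⟩

theorem Module.Injective.of_linearEquiv {R : Type u} {M N : Type u} [Ring R] [AddCommGroup M]
    [Module R M] [AddCommGroup N] [Module R N] (e : M ≃ₗ[R] N) (h : Module.Injective R M) :
    Module.Injective R N :=
  ((Module.Baer.iff_injective.2 h).of_equiv e).injective

theorem Module.exists_injective_embedding (R : Type u) [Ring R] (M : Type u) [AddCommGroup M]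
    [Module R M] : ∃ (E : Type u) (_ : AddCommGroup E) (_ : Module R E) (i : M →ₗ[R] E),
      Module.Injective R E ∧ Function.Injective i := by
  obtain ⟨P⟩ := CategoryTheory.EnoughInjectives.presentation (ModuleCat.of R M)
  exact ⟨P.J, inferInstance, inferInstance, P.f.hom,
    Module.injective_module_of_injective_object R P.J (inj := P.injective),
    (ModuleCat.mono_iff_injective P.f).1 P.mono⟩

/-- The range of an injective linear map `M → E` is the intersection, inside `E × (E ⧸ M)`, of
`E × 0` with the graph of the quotient map, both of which are copies of `E`. -/
theorem LinearMap.exists_submodules_equiv_inf_equiv {R : Type u} [Ring R] {M E : Type u}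
    [AddCommGroup M] [Module R M] [AddCommGroup E] [Module R E] (i : M →ₗ[R] E)
    (hi : Function.Injective i) :
    ∃ (G : Type u) (_ : AddCommGroup G) (_ : Module R G) (A B : Submodule R G),
      Nonempty (E ≃ₗ[R] A) ∧ Nonempty (E ≃ₗ[R] B) ∧ Nonempty (↥(A ⊓ B) ≃ₗ[R] M) := by
  let q := i.range.mkQ
  have hA : Function.Injective (LinearMap.inl R E (E ⧸ i.range)) := LinearMap.inl_injective
  have hB : Function.Injective (LinearMap.id.prod q) := fun x y h ↦ congrArg Prod.fst h
  have hinf : (LinearMap.inl R E (E ⧸ i.range) ∘ₗ i).range =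
      (LinearMap.inl R E (E ⧸ i.range)).range ⊓ (LinearMap.id.prod q).range := by
    ext ⟨x, y⟩
    constructor
    · rintro ⟨m, hm⟩
      obtain ⟨rfl, rfl⟩ := Prod.ext_iff.1 hm
      refine ⟨⟨i m, rfl⟩, i m, Prod.ext rfl ?_⟩
      exact (Submodule.Quotient.mk_eq_zero _).2 ⟨m, rfl⟩
    · rintro ⟨⟨a, ha⟩, b, hb⟩
      obtain ⟨rfl, rfl⟩ := Prod.ext_iff.1 ha
      obtain ⟨h, hb⟩ := Prod.ext_iff.1 hb
      obtain rfl : b = a := h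
      obtain ⟨m, rfl⟩ := (Submodule.Quotient.mk_eq_zero i.range).1 hb
      exact ⟨m, rfl⟩
  have hAi : Function.Injective (LinearMap.inl R E (E ⧸ i.range) ∘ₗ i) := hA.comp hi
  exact ⟨E × (E ⧸ i.range), inferInstance, inferInstance, _, _, ⟨.ofInjective _ hA⟩,
    ⟨.ofInjective _ hB⟩,
    ⟨(LinearEquiv.ofEq _ _ hinf.symm).trans (LinearEquiv.ofInjective _ hAi).symm⟩⟩

theorem Aleph0Injective.exists_isCompl {R : Type*} [Ring R] {I : Ideal R}
    (h : Aleph0Injective R I) (hI : IdealCountablyGenerated I) :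
    I.FG ∧ ∃ J : Ideal R, IsCompl I J := by
  obtain ⟨g, hg⟩ := h I hI LinearMap.id
  refine ⟨?_, g.ker, LinearMap.isCompl_of_proj hg⟩
  have : Module.Finite R I := Module.Finite.of_surjective g fun x ↦ ⟨x, hg x⟩
  exact Module.Finite.iff_fg.1 this

theorem isSemisimpleRing_of_forall_ideal_aleph0Injective {R : Type*} [Ring R]
    (h : ∀ I : Ideal R, Aleph0Injective R I) : IsSemisimpleRing R := by
  have hN : IsNoetherian R R := by
    rw [isNoetherian_iff_fg_wellFounded, wellFoundedGT_iff_monotone_chain_condition]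
    intro a
    have hI : IdealCountablyGenerated (⨆ n, (a n : Ideal R)) := by
      choose s hs using fun n ↦ (a n).2
      exact ⟨⋃ n, (s n : Set R), Set.countable_iUnion fun n ↦ (s n).countable_toSet,
        (Submodule.span_iUnion _).trans (iSup_congr hs)⟩
    obtain ⟨n, hn⟩ := Submodule.FG.stabilizes_of_iSup_eq ((h _).exists_isCompl hI).1
      ⟨fun n ↦ (a n : Ideal R), fun _ _ hnm ↦ a.monotone hnm⟩ rfl
    refine ⟨n, fun m hm ↦ (a.monotone hm).antisymm ?_⟩
    exact (le_iSup (fun n ↦ (a n : Ideal R)) m).trans hn.le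
  have : ComplementedLattice (Ideal R) := ⟨fun I ↦ by
    obtain ⟨s, hs⟩ := IsNoetherian.noetherian I
    exact ((h I).exists_isCompl ⟨s, s.countable_toSet, hs⟩).2⟩
  exact { toComplementedLattice := this }

/-- For a ring `R` the following are equivalent: (1) `R` is semisimple Artinian;
(2) the intersection of any two injective submodules of a module is injective;
(3) the intersection of any two ℵ₀-injective submodules of a module is ℵ₀-injective. -/
theorem semisimple_iff_inter_injective_iff_inter_aleph0Injective (R : Type u) [Ring R] :
    List.TFAE
      [ IsSemisimpleRing R,
        ∀ (E : Type u) [AddCommGroup E] [Module R E] (A B : Submodule R E),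
          Module.Injective R A → Module.Injective R B → Module.Injective R ↥(A ⊓ B),
        ∀ (E : Type u) [AddCommGroup E] [Module R E] (A B : Submodule R E),
          Aleph0Injective R A → Aleph0Injective R B → Aleph0Injective R ↥(A ⊓ B) ] := by
  tfae_have 1 → 2 := fun _ E _ _ A B _ _ ↦ Module.injective_of_isSemisimpleRing R _
  tfae_have 1 → 3 := fun _ E _ _ A B _ _ ↦
    .of_baer (Module.Baer.iff_injective.2 (Module.injective_of_isSemisimpleRing R _))
  tfae_have 2 → 1 := by
    refine fun h ↦ isSemisimpleRing_of_forall_ideal_aleph0Injective fun I ↦ ?_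
    obtain ⟨E, _, _, i, hE, hi⟩ := Module.exists_injective_embedding R I
    obtain ⟨G, _, _, A, B, ⟨eA⟩, ⟨eB⟩, ⟨e⟩⟩ := i.exists_submodules_equiv_inf_equiv hi
    exact .of_equiv e (.of_baer (Module.Baer.iff_injective.2
      (h G A B (hE.of_linearEquiv eA) (hE.of_linearEquiv eB))))
  tfae_have 3 → 1 := by
    refine fun h ↦ isSemisimpleRing_of_forall_ideal_aleph0Injective fun I ↦ ?_
    obtain ⟨E, _, _, i, hE, hi⟩ := Module.exists_injective_embedding R I
    obtain ⟨G, _, _, A, B, ⟨eA⟩, ⟨eB⟩, ⟨e⟩⟩ := i.exists_submodules_equiv_inf_equiv hi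
    have hE : Aleph0Injective R E := .of_baer (Module.Baer.iff_injective.2 hE)
    exact .of_equiv e (h G A B (hE.of_equiv eA) (hE.of_equiv eB))
  tfae_finish
end

section
/- Let R be a ring, M an R-module, and I an ideal of R with I ⊆ Ann(M), so that M carries the induced R/I-module structure. If M is an ℵ₀-injective R-module, then M is an ℵ₀-injective R/I-module. Conversely, if R is fully idempotent (every ideal J of R satisfies J = J², i.e. J equals the ideal generated by products of pairs of its elements) and M is an ℵ₀-injective R/I-module, then M is an ℵ₀-injective R-module. -/
universe u

theorem IdealCountablyGenerated.map {R S : Type*} [Ring R] [Ring S] {J : Ideal R}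
    (hJ : IdealCountablyGenerated J) (π : R →+* S) : IdealCountablyGenerated (J.map π) := by
  obtain ⟨s, hs, rfl⟩ := hJ
  exact ⟨π '' s, hs.image π, (Ideal.map_span π s).symm⟩

theorem IdealCountablyGenerated.exists_map_eq {R S : Type*} [Ring R] [Ring S] {J : Ideal S}
    (hJ : IdealCountablyGenerated J) {π : R →+* S} (hπ : Function.Surjective π) :
    ∃ J' : Ideal R, IdealCountablyGenerated J' ∧ J'.map π = J := by
  obtain ⟨s, hs, rfl⟩ := hJ
  refine ⟨Ideal.span (Function.surjInv hπ '' s), ⟨_, hs.image _, rfl⟩, ?_⟩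
  rw [Ideal.map_span, Set.image_image]
  simp only [Function.surjInv_eq, Set.image_id']

theorem aleph0Injective_iff_exists_smul {R M : Type*} [Ring R] [AddCommGroup M] [Module R M] :
    Aleph0Injective R M ↔ ∀ J : Ideal R, IdealCountablyGenerated J →
      ∀ f : J →ₗ[R] M, ∃ m : M, ∀ x : J, f x = (x : R) • m := by
  refine forall₃_congr fun J _ f => ⟨fun ⟨g, hg⟩ => ⟨g 1, fun x => ?_⟩, fun ⟨m, hm⟩ =>
    ⟨LinearMap.toSpanSingleton R M m, fun x => ?_⟩⟩
  · rw [← map_smul, smul_eq_mul, mul_one, hg]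
  · rw [LinearMap.toSpanSingleton_apply, hm]

/-- A linear map on an ideal `J` that vanishes on `J ⊓ ker π` descends to the image of `J`. -/
theorem exists_linearMap_map_of_vanish_ker {R S M : Type*} [Ring R] [Ring S]
    [AddCommGroup M] [Module R M] [Module S M] {π : R →+* S} (hπ : Function.Surjective π)
    (hcompat : ∀ (r : R) (m : M), π r • m = r • m) {J : Ideal R} (f : J →ₗ[R] M)
    (hf : ∀ x : J, π x = 0 → f x = 0) :
    ∃ g : J.map π →ₗ[S] M, ∀ x : J, g ⟨π x, Ideal.mem_map_of_mem π x.2⟩ = f x := by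
  have hlift (y : J.map π) : ∃ x : J, π x = y := by
    obtain ⟨x, hx, hxy⟩ := (Ideal.mem_map_iff_of_surjective π hπ).1 y.2
    exact ⟨⟨x, hx⟩, hxy⟩
  choose l hl using hlift
  have hf' {x y : J} (h : π x = π y) : f x = f y := by
    rw [← sub_eq_zero, ← map_sub]
    exact hf _ (by simp [h])
  refine ⟨⟨⟨fun y => f (l y), fun a b => ?_⟩, fun s a => ?_⟩, fun x => hf' (hl _)⟩
  · rw [← map_add]
    exact hf' (by simp [hl])
  · obtain ⟨r, rfl⟩ := hπ s
    simp only [RingHom.id_apply]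
    rw [hcompat, ← map_smul]
    exact hf' (by simp [hl])

/-- Over a ring whose left ideals are idempotent, a linear map from an ideal to a module
vanishes on the elements of any ideal annihilating the module. -/
theorem linearMap_eq_zero_of_idempotent_of_mem_annihilating {R M : Type*} [Ring R]
    [AddCommGroup M] [Module R M]
    (hidem : ∀ J : Ideal R, J = Ideal.span {x : R | ∃ a ∈ J, ∃ b ∈ J, x = a * b})
    {K : Ideal R} (hK : ∀ r ∈ K, ∀ m : M, r • m = 0) {J : Ideal R} (f : J →ₗ[R] M) (x : J)
    (hx : (x : R) ∈ K) : f x = 0 := by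
  have hle : J ⊓ K ≤ (LinearMap.ker f).map J.subtype := by
    rw [hidem (J ⊓ K), Ideal.span_le]
    rintro _ ⟨a, ha, b, hb, rfl⟩
    refine ⟨a • ⟨b, hb.1⟩, ?_, rfl⟩
    rw [SetLike.mem_coe, LinearMap.mem_ker, map_smul, hK a ha.2]
  obtain ⟨y, hy, hyx⟩ := hle ⟨x.2, hx⟩
  rwa [← Subtype.ext hyx]

/-- Change of rings along a quotient.  The quotient ring `R/I` (for an ideal
`I ⊆ Ann(M)`) is encoded as a ring `S` together with a surjective ring homomorphism
`π : R →+* S` whose kernel is contained in `Ann(M)`; the induced `R/I`-module structure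
on `M` is encoded by the compatibility condition `π r • m = r • m`.  If `M` is
ℵ₀-injective over `R` then it is ℵ₀-injective over `S = R/I`; conversely, if `R` is
fully idempotent (every ideal equals the ideal generated by products of pairs of its
elements) and `M` is ℵ₀-injective over `S = R/I`, then `M` is ℵ₀-injective over `R`. -/
theorem aleph0Injective_quotient_ring (R S M : Type u) [Ring R] [Ring S]
    [AddCommGroup M] [Module R M] [Module S M]
    (π : R →+* S) (hsurj : Function.Surjective π)
    (hker : ∀ r ∈ RingHom.ker π, ∀ m : M, r • m = 0)
    (hcompat : ∀ (r : R) (m : M), π r • m = r • m) :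
    (Aleph0Injective R M → Aleph0Injective S M) ∧
      ((∀ J : Ideal R, J = Ideal.span {x : R | ∃ a ∈ J, ∃ b ∈ J, x = a * b}) →
        Aleph0Injective S M → Aleph0Injective R M) := by
  simp only [aleph0Injective_iff_exists_smul]
  refine ⟨fun h J hJ f => ?_, fun hidem h J hJ f => ?_⟩
  · obtain ⟨J', hJ', rfl⟩ := hJ.exists_map_eq hsurj
    let f' : J' →ₗ[R] M :=
      { toFun := fun x => f ⟨π x, Ideal.mem_map_of_mem π x.2⟩
        map_add' := fun x y => by
          rw [← map_add]
          exact congrArg f (Subtype.ext (map_add π _ _))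
        map_smul' := fun r x => by
          rw [RingHom.id_apply, ← hcompat, ← map_smul]
          exact congrArg f (Subtype.ext (map_mul π _ _)) }
    obtain ⟨m, hm⟩ := h J' hJ' f'
    refine ⟨m, fun ⟨y, hy⟩ => ?_⟩
    obtain ⟨x, hx, rfl⟩ := (Ideal.mem_map_iff_of_surjective π hsurj).1 hy
    rw [hcompat]
    exact hm ⟨x, hx⟩
  · obtain ⟨g, hg⟩ := exists_linearMap_map_of_vanish_ker hsurj hcompat f
      (linearMap_eq_zero_of_idempotent_of_mem_annihilating hidem hker f)
    obtain ⟨m, hm⟩ := h _ (hJ.map π) g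
    exact ⟨m, fun x => by rw [← hg, hm, hcompat]⟩
end

section
/- If R is a commutative ℵ₀-self-injective ring, then for any two countably generated ideals I₁ and I₂ of R one has Ann(I₁ ∩ I₂) = Ann(I₁) + Ann(I₂). -/
universe u

theorem IdealCountablyGenerated.sup {R : Type*} [Ring R] {I J : Ideal R}
    (hI : IdealCountablyGenerated I) (hJ : IdealCountablyGenerated J) :
    IdealCountablyGenerated (I ⊔ J) := by
  obtain ⟨s, hs, rfl⟩ := hI
  obtain ⟨t, ht, rfl⟩ := hJ
  exact ⟨s ∪ t, hs.union ht, Ideal.span_union s t⟩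

/-- If `R` is a commutative ℵ₀-self-injective ring, then for any two countably generated
ideals `I₁, I₂` of `R` one has `Ann(I₁ ∩ I₂) = Ann(I₁) + Ann(I₂)`. -/
theorem ann_inf_eq_sup_ann_of_aleph0SelfInjective (R : Type u) [CommRing R]
    (hR : Aleph0Injective R R) (I₁ I₂ : Ideal R)
    (h₁ : IdealCountablyGenerated I₁) (h₂ : IdealCountablyGenerated I₂) :
    Module.annihilator R ↥(I₁ ⊓ I₂) = Module.annihilator R ↥I₁ ⊔ Module.annihilator R ↥I₂ := by
  refine le_antisymm (fun x hx => ?_) (sup_le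
    (Submodule.annihilator_mono inf_le_left) (Submodule.annihilator_mono inf_le_right))
  have hx0 : ∀ a ∈ I₁ ⊓ I₂, x * a = 0 := Submodule.mem_annihilator.mp hx
  let p : R →ₗ.[R] R := ⟨I₁, x • I₁.subtype⟩
  let q : R →ₗ.[R] R := ⟨I₂, 0⟩
  have hpq : ∀ (a : p.domain) (b : q.domain), (a : R) = b → p a = q b := fun a b hab =>
    hx0 a ⟨a.2, hab ▸ b.2⟩
  -- The map `a + b ↦ x * a` on `I₁ ⊔ I₂` is multiplication by some `g 1`.
  obtain ⟨g, hg⟩ := hR (I₁ ⊔ I₂) (h₁.sup h₂) (p.sup q hpq).toFun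
  have hmul : ∀ a, g a = g 1 * a := fun a => by
    rw [mul_comm, ← smul_eq_mul, ← map_smul, smul_eq_mul, mul_one]
  have hg₁ : ∀ a ∈ I₁, g a = x * a := fun a ha =>
    (hg ⟨a, Submodule.mem_sup_left ha⟩).trans ((p.left_le_sup q hpq).2 (x := ⟨a, ha⟩) rfl).symm
  have hg₂ : ∀ b ∈ I₂, g b = 0 := fun b hb =>
    (hg ⟨b, Submodule.mem_sup_right hb⟩).trans ((p.right_le_sup q hpq).2 (x := ⟨b, hb⟩) rfl).symm
  refine Submodule.mem_sup.mpr ⟨x - g 1, ?_, g 1, ?_, sub_add_cancel x (g 1)⟩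
  · refine Submodule.mem_annihilator.mpr fun a ha => ?_
    rw [smul_eq_mul, sub_mul, ← hmul, hg₁ a ha, sub_self]
  · refine Submodule.mem_annihilator.mpr fun b hb => ?_
    rw [smul_eq_mul, ← hmul, hg₂ b hb]
end

section
/- Let X be a completely regular topological space and let C(X) denote the ring of continuous real-valued functions on X. Then the following are equivalent: (1) for any two ideals A and B of C(X) with A ∩ B = (0), one has Ann(A) + Ann(B) = C(X); (2) X is extremally disconnected, i.e. the closure of every open subset of X is open. -/
universe u

open Set in
/-- On a completely regular space, a function annihilating every function that vanishes outside
the open set `U` vanishes on the closure of `U`. -/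
theorem ContinuousMap.eqOn_zero_closure_of_mem_annihilator_idealOfSet {X : Type*}
    [TopologicalSpace X] [CompletelyRegularSpace X] {U : Set X} (hU : IsOpen U) {f : C(X, ℝ)}
    (hf : f ∈ Module.annihilator C(X, ℝ) (ContinuousMap.idealOfSet ℝ U)) :
    EqOn f 0 (closure U) := by
  refine EqOn.closure (fun x hx => ?_) f.continuous continuous_const
  obtain ⟨k, hk, hkx, hkU⟩ := CompletelyRegularSpace.completely_regular_isOpen x U hU hx
  let h : C(X, ℝ) := ⟨fun y => 1 - k y, by fun_prop⟩
  have hh : h ∈ ContinuousMap.idealOfSet ℝ U := by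
    rw [ContinuousMap.mem_idealOfSet]
    intro y hy
    simp [h, hkU hy]
  have hfh : f * h = 0 := congrArg Subtype.val (Module.mem_annihilator.1 hf ⟨h, hh⟩)
  simpa [h, hkx] using DFunLike.congr_fun hfh x

open Set in
/-- If two ideals of `C(X, ℝ)` meet trivially, every element of the second vanishes on the closure
of the union of the cozero sets of the first. -/
theorem ContinuousMap.eqOn_zero_closure_iUnion_support {X : Type*} [TopologicalSpace X]
    {A B : Ideal C(X, ℝ)} (hAB : A ⊓ B = ⊥) {b : C(X, ℝ)} (hb : b ∈ B) :
    EqOn b 0 (closure (⋃ a ∈ A, Function.support a)) := by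
  refine EqOn.closure (fun x hx => ?_) b.continuous continuous_const
  obtain ⟨a, ha, hax⟩ := mem_iUnion₂.1 hx
  have hab : a * b ∈ A ⊓ B := ⟨A.mul_mem_right b ha, B.mul_mem_left a hb⟩
  rw [hAB, Ideal.mem_bot] at hab
  exact (mul_eq_zero.1 (DFunLike.congr_fun hab x)).resolve_left hax

/-- For a completely regular space `X`, the following are equivalent:
(1) for any two ideals `A`, `B` of `C(X)` with `A ∩ B = (0)`, `Ann(A) + Ann(B) = C(X)`;
(2) `X` is extremally disconnected (the closure of every open set is open). -/
theorem extremallyDisconnected_iff_ann_add_ann (X : Type u) [TopologicalSpace X]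
    [CompletelyRegularSpace X] :
    (∀ A B : Ideal C(X, ℝ), A ⊓ B = ⊥ →
        Module.annihilator C(X, ℝ) ↥A ⊔ Module.annihilator C(X, ℝ) ↥B = ⊤) ↔
      ExtremallyDisconnected X := by
  constructor
  · refine fun H => ⟨fun U hU => ?_⟩
    have hV : IsOpen (closure U)ᶜ := isClosed_closure.isOpen_compl
    have hAB : ContinuousMap.idealOfSet ℝ U ⊓ ContinuousMap.idealOfSet ℝ (closure U)ᶜ = ⊥ := by
      refine (Submodule.eq_bot_iff _).2 fun h hh => ContinuousMap.ext fun x => ?_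
      by_cases hx : x ∈ closure U
      · exact ContinuousMap.mem_idealOfSet.1 hh.2 (not_not.2 hx)
      · exact ContinuousMap.mem_idealOfSet.1 hh.1 fun hxU => hx (subset_closure hxU)
    obtain ⟨f, hf, g, hg, hfg⟩ := Submodule.mem_sup.1 ((Ideal.eq_top_iff_one _).1 (H _ _ hAB))
    have hf0 := ContinuousMap.eqOn_zero_closure_of_mem_annihilator_idealOfSet hU hf
    have hg0 := ContinuousMap.eqOn_zero_closure_of_mem_annihilator_idealOfSet hV hg
    have hclosure : closure U = {x | f x ≠ 1} := by
      ext x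
      refine ⟨fun hx => by simp [hf0 hx], fun hfx => ?_⟩
      by_contra hx
      have hgx : g x = 0 := hg0 (subset_closure hx)
      have hsum : f x + g x = 1 := DFunLike.congr_fun hfg x
      exact hfx (by simpa [hgx] using hsum)
    rw [hclosure]
    exact isOpen_ne_fun f.continuous continuous_const
  · intro hX A B hAB
    set U : Set X := ⋃ a ∈ A, Function.support a
    have hU : IsOpen U := isOpen_biUnion fun a _ => a.continuous.isOpen_support
    have hK : IsClopen (closure U) := ⟨isClosed_closure, hX.open_closure U hU⟩
    let e : C(X, ℝ) := ⟨(closure U).indicator 1, hK.continuous_indicator continuous_one⟩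
    have he : e ∈ Module.annihilator C(X, ℝ) B := by
      refine Module.mem_annihilator.2 fun b => Subtype.ext (ContinuousMap.ext fun x => ?_)
      change (closure U).indicator 1 x * b.1 x = 0
      by_cases hx : x ∈ closure U
      · simp [ContinuousMap.eqOn_zero_closure_iUnion_support hAB b.2 hx]
      · simp [hx]
    have he' : 1 - e ∈ Module.annihilator C(X, ℝ) A := by
      refine Module.mem_annihilator.2 fun a => Subtype.ext (ContinuousMap.ext fun x => ?_)
      change (1 - (closure U).indicator 1 x) * a.1 x = 0
      by_cases hx : x ∈ closure U
      · simp [hx]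
      · have hax : a.1 x = 0 := by
          by_contra hax
          exact hx (subset_closure (Set.mem_iUnion₂.2 ⟨a.1, a.2, hax⟩))
        simp [hax]
    exact (Ideal.eq_top_iff_one _).2 (Submodule.mem_sup.2 ⟨1 - e, he', e, he, by ring⟩)
end

section
/- For a Boolean ring R the following are equivalent: (1) for any two ideals I₁ and I₂ of R, Ann(I₁ ∩ I₂) = Ann(I₁) + Ann(I₂); (2) for any two ideals A and B of R with A ∩ B = (0), Ann(A) + Ann(B) = R; (3) R is self-injective, i.e. R is injective as a module over itself. -/
universe u

/-- Over a self-injective commutative ring, `Ann(I ∩ J) = Ann(I) + Ann(J)`: extend multiplication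
by `r ∈ Ann(I ∩ J)` along `R ⧸ (I ∩ J) → (R ⧸ I) × (R ⧸ J)`. -/
theorem Module.Injective.annihilator_inf {R : Type u} [CommRing R] [Module.Injective R R]
    (I J : Ideal R) :
    Module.annihilator R ↥(I ⊓ J) = Module.annihilator R ↥I ⊔ Module.annihilator R ↥J := by
  apply le_antisymm
  · intro r hr
    rw [Submodule.mem_annihilator] at hr
    have hker : (I.mkQ.prod J.mkQ).ker = I ⊓ J := by
      simp [LinearMap.ker_prod]
    let i : (R ⧸ (I ⊓ J)) →ₗ[R] (R ⧸ I) × (R ⧸ J) :=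
      (I ⊓ J).liftQ (I.mkQ.prod J.mkQ) hker.ge
    have hi : Function.Injective i := by
      rw [← LinearMap.ker_eq_bot]
      exact Submodule.ker_liftQ_eq_bot _ _ _ hker.le
    let f : (R ⧸ (I ⊓ J)) →ₗ[R] R :=
      (I ⊓ J).liftQ (LinearMap.mulLeft R r) fun x hx => hr x hx
    obtain ⟨h, hh⟩ := Module.Injective.out i hi f
    have hsum : h (I.mkQ 1, 0) + h (0, J.mkQ 1) = r := by
      rw [← map_add, Prod.mk_add_mk, add_zero, zero_add]
      exact (hh ((I ⊓ J).mkQ 1)).trans (mul_one r)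
    rw [← hsum]
    refine Submodule.add_mem_sup ?_ ?_ <;> rw [Submodule.mem_annihilator] <;> intro x hx
    · have hx0 : x • I.mkQ 1 = 0 := by
        rw [← map_smul, Submodule.mkQ_apply, Submodule.Quotient.mk_eq_zero]
        simpa using hx
      rw [smul_eq_mul, mul_comm, ← smul_eq_mul, ← map_smul, Prod.smul_mk, hx0, smul_zero]
      exact map_zero h
    · have hx0 : x • J.mkQ 1 = 0 := by
        rw [← map_smul, Submodule.mkQ_apply, Submodule.Quotient.mk_eq_zero]
        simpa using hx
      rw [smul_eq_mul, mul_comm, ← smul_eq_mul, ← map_smul, Prod.smul_mk, hx0, smul_zero]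
      exact map_zero h
  · exact sup_le (Submodule.annihilator_mono inf_le_left) (Submodule.annihilator_mono inf_le_right)

/-- A Boolean ring in which the annihilators of any two disjoint ideals are comaximal satisfies
Baer's criterion: apply the hypothesis to the ranges of `g` and of `x ↦ x - g x`. -/
theorem BooleanRing.baer_of_annihilator_sup_eq_top {R : Type u} [BooleanRing R]
    (H : ∀ A B : Ideal R, A ⊓ B = ⊥ →
      Module.annihilator R ↥A ⊔ Module.annihilator R ↥B = ⊤) :
    Module.Baer R R := by
  intro I g
  have g_mul (x : I) : g x = g x * x := by
    have hx : (x : R) • x = x := Subtype.ext (BooleanRing.mul_self (x : R))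
    conv_lhs => rw [← hx, map_smul, smul_eq_mul, mul_comm]
  have g_mem (x : I) : g x ∈ I := by
    rw [g_mul]
    exact I.mul_mem_left _ x.2
  have g_g (x : I) : g ⟨g x, g_mem x⟩ = g x := by
    have hx : (⟨g x, g_mem x⟩ : I) = g x • x := Subtype.ext (g_mul x)
    rw [hx, map_smul, smul_eq_mul, BooleanRing.mul_self]
  have hdisj : LinearMap.range g ⊓ LinearMap.range (I.subtype - g) = ⊥ := by
    rw [eq_bot_iff]
    rintro z ⟨⟨x, hx⟩, ⟨y, hy⟩⟩
    have hz : (⟨g x, g_mem x⟩ : I) = y - ⟨g y, g_mem y⟩ :=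
      Subtype.ext (hx.trans hy.symm)
    have hgz := g_g x
    rw [hz, map_sub, g_g, sub_self] at hgz
    rw [Submodule.mem_bot, ← hx, ← hgz]
  have htop := H _ _ hdisj
  obtain ⟨a, ha, b, hb, hab⟩ := Submodule.mem_sup.1 (htop ▸ Submodule.mem_top : (1 : R) ∈ _)
  rw [Submodule.mem_annihilator] at ha hb
  refine ⟨LinearMap.mulLeft R b, fun x hx => ?_⟩
  have h₁ : a * g ⟨x, hx⟩ = 0 := ha _ ⟨_, rfl⟩
  have h₂ : b * (x - g ⟨x, hx⟩) = 0 := hb _ ⟨⟨x, hx⟩, rfl⟩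
  rw [LinearMap.mulLeft_apply]
  linear_combination h₂ - h₁ + g ⟨x, hx⟩ * hab

/-- For a Boolean ring `R` the following are equivalent:
(1) `Ann(I₁ ∩ I₂) = Ann(I₁) + Ann(I₂)` for all ideals `I₁, I₂`;
(2) `Ann(A) + Ann(B) = R` for all ideals `A, B` with `A ∩ B = (0)`;
(3) `R` is self-injective, i.e. injective as a module over itself. -/
theorem booleanRing_selfInjective_tfae (R : Type u) [BooleanRing R] :
    List.TFAE
      [ ∀ I₁ I₂ : Ideal R,
          Module.annihilator R ↥(I₁ ⊓ I₂) =
            Module.annihilator R ↥I₁ ⊔ Module.annihilator R ↥I₂,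
        ∀ A B : Ideal R, A ⊓ B = ⊥ →
          Module.annihilator R ↥A ⊔ Module.annihilator R ↥B = ⊤,
        Module.Injective R R ] := by
  tfae_have 1 → 2 := fun H A B hAB => by
    rw [← H, hAB]
    exact Submodule.annihilator_bot
  tfae_have 2 → 3 := fun H => (BooleanRing.baer_of_annihilator_sup_eq_top H).injective
  tfae_have 3 → 1 := fun _ => Module.Injective.annihilator_inf
  tfae_finish
end

section
/- Let R be a von Neumann regular ring and M an R-module with A = Ann(M). Then M is Σ-ℵ₀-injective if and only if the quotient ring R/A is Artinian. -/
universe u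

/-- In a von Neumann regular ring every finitely generated left ideal contains a right identity
element for itself. -/
lemma Ideal.FG.exists_right_identity {R : Type*} [Ring R]
    (hreg : ∀ a : R, ∃ x : R, a = a * x * a) (I : Ideal R) (hI : I.FG) :
    ∃ e ∈ I, ∀ x ∈ I, x * e = x := by
  induction I, hI using Submodule.fg_induction with
  | singleton a =>
    obtain ⟨x, hx⟩ := hreg a
    refine ⟨x * a, Ideal.mul_mem_left _ _ (Ideal.mem_span_singleton_self a), fun y hy => ?_⟩
    obtain ⟨z, rfl⟩ := Ideal.mem_span_singleton'.1 hy
    rw [mul_assoc, ← mul_assoc a, ← hx]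
  | sup I J _ _ hI hJ =>
    obtain ⟨e, heI, he⟩ := hI
    obtain ⟨f, hfJ, hf⟩ := hJ
    obtain ⟨y, hy⟩ := hreg (f - f * e)
    have heS : e ∈ I ⊔ J := Ideal.mem_sup_left heI
    have hfS : f ∈ I ⊔ J := Ideal.mem_sup_right hfJ
    set g := y * (f - f * e) with hg
    have hgS : g ∈ I ⊔ J := Ideal.mul_mem_left _ _ (sub_mem hfS (Ideal.mul_mem_left _ _ heS))
    have hee : e * e = e := he e heI
    have heh : e * (e + (g - e * g)) = e := by
      rw [mul_add, mul_sub, ← mul_assoc e e g, hee, sub_self, add_zero]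
    have hfh : f * (e + (g - e * g)) = f := by
      have : f * (e + (g - e * g)) = f * e + (f - f * e) * g := by noncomm_ring
      rw [this, hg, ← mul_assoc, ← hy, add_sub_cancel]
    refine ⟨e + (g - e * g), add_mem heS (sub_mem hgS (Ideal.mul_mem_left _ _ hgS)),
      fun x hx => ?_⟩
    obtain ⟨a, ha, b, hb, rfl⟩ := Submodule.mem_sup.1 hx
    have h₁ : a * (e + (g - e * g)) = a := by
      conv_lhs => rw [← he a ha, mul_assoc, heh, he a ha]
    have h₂ : b * (e + (g - e * g)) = b := by
      conv_lhs => rw [← hf b hb, mul_assoc, hfh, hf b hb]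
    rw [add_mul, h₁, h₂]

/-- A von Neumann regular left Noetherian ring is left Artinian. -/
lemma IsNoetherianRing.isArtinianRing_of_regular {R : Type*} [Ring R] [IsNoetherianRing R]
    (hreg : ∀ a : R, ∃ x : R, a = a * x * a) : IsArtinianRing R := by
  have : IsSemisimpleRing R := by
    refine (isSemisimpleModule_iff R R).2 ⟨fun I => ?_⟩
    obtain ⟨e, heI, he⟩ :=
      Ideal.FG.exists_right_identity hreg I (IsNoetherian.noetherian I)
    refine ⟨LinearMap.ker (LinearMap.toSpanSingleton R R e), ?_, ?_⟩
    · refine Submodule.disjoint_def.2 fun x hx hx' => ?_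
      rw [LinearMap.mem_ker, LinearMap.toSpanSingleton_apply, smul_eq_mul, he x hx] at hx'
      exact hx'
    · refine codisjoint_iff.2 (eq_top_iff.2 fun x _ => ?_)
      refine Submodule.mem_sup.2 ⟨x * e, Ideal.mul_mem_left _ _ heI, x - x * e, ?_, by abel⟩
      rw [LinearMap.mem_ker, LinearMap.toSpanSingleton_apply, smul_eq_mul, sub_mul, mul_assoc,
        he e heI, sub_self]
  infer_instance

/-- If a countable direct sum of copies of `M` is ℵ₀-injective, there is no infinite triangular
system of scalars and vectors with nonzero diagonal. -/
lemma Aleph0Injective.exists_smul_eq_zero {R : Type*} {M : Type*} [Ring R] [AddCommGroup M]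
    [Module R M] {ι : Type*} (σ : ι ≃ ℕ) (h : Aleph0Injective R (DirectSum ι fun _ => M))
    (r : ℕ → R) (m : ℕ → M) (hrm : ∀ n k, n < k → r n • m k = 0) :
    ∃ n, r n • m n = 0 := by
  classical
  set I : Ideal R := Ideal.span (Set.range r) with hI
  have hmem : ∀ n, r n ∈ I := fun n => Ideal.subset_span ⟨n, rfl⟩
  have key : ∀ x : I, ∃ y : DirectSum ι fun _ => M, ∀ i, y i = (x : R) • m (σ i) := by
    rintro ⟨x, hx⟩
    induction hx using Submodule.span_induction with
    | mem x hx =>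
      obtain ⟨n, rfl⟩ := hx
      refine ⟨DFinsupp.mk ((Finset.range (n + 1)).map σ.symm.toEmbedding)
        fun i => r n • m (σ i), fun i => ?_⟩
      refine DFinsupp.mk_apply.trans ?_
      split_ifs with hi
      · rfl
      · refine (hrm n (σ i) ?_).symm
        by_contra hlt
        exact hi (Finset.mem_map.2 ⟨σ i, Finset.mem_range.2 (by omega), by simp⟩)
    | zero => exact ⟨0, fun i => by simp⟩
    | add x y _ _ hx hy =>
      obtain ⟨a, ha⟩ := hx
      obtain ⟨b, hb⟩ := hy
      exact ⟨a + b, fun i => by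
        rw [DirectSum.add_apply, ha, hb]; exact (add_smul _ _ _).symm⟩
    | smul c x _ hx =>
      obtain ⟨a, ha⟩ := hx
      exact ⟨c • a, fun i => by
        rw [DirectSum.smul_apply, ha]; exact (mul_smul _ _ _).symm⟩
  choose f hf using key
  let F : I →ₗ[R] DirectSum ι fun _ => M :=
    { toFun := f
      map_add' := fun x y => DFinsupp.ext fun i => by
        rw [DirectSum.add_apply, hf, hf, hf]; exact add_smul _ _ _
      map_smul' := fun c x => DFinsupp.ext fun i => by
        rw [RingHom.id_apply, DirectSum.smul_apply, hf, hf]; exact mul_smul _ _ _ }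
  obtain ⟨g, hg⟩ := h I ⟨_, Set.countable_range r, rfl⟩ F
  have : Infinite ι := Infinite.of_injective σ.symm σ.symm.injective
  obtain ⟨i, hi⟩ := Infinite.exists_notMem_finset (DFinsupp.support (g 1))
  refine ⟨σ i, ?_⟩
  have hgr : g (r (σ i)) = r (σ i) • g 1 := by rw [← map_smul, smul_eq_mul, mul_one]
  have h0 : (g 1) i = 0 := DFinsupp.notMem_support_iff.1 hi
  rw [← hf ⟨r (σ i), hmem _⟩ i, show f _ = g (r (σ i)) from (hg ⟨r (σ i), hmem _⟩).symm, hgr,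
    DirectSum.smul_apply, h0, smul_zero]

/-- Let `R` be a von Neumann regular ring and `M` an `R`-module with `A = Ann(M)`.
The quotient ring `R/A` is encoded as a ring `S` with a surjective ring homomorphism
`π : R →+* S` whose kernel is `A`.  Then `M` is Σ-ℵ₀-injective (every direct sum of
copies of `M` is ℵ₀-injective) iff `R/A` is an Artinian ring. -/
theorem sigma_aleph0Injective_iff_quotient_artinian (R : Type u) [Ring R]
    (hreg : ∀ a : R, ∃ x : R, a = a * x * a)
    (M : Type u) [AddCommGroup M] [Module R M]
    (S : Type u) [Ring S] (π : R →+* S) (hsurj : Function.Surjective π)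
    (hker : RingHom.ker π = Module.annihilator R M) :
    (∀ Λ : Type u, Aleph0Injective R (DirectSum Λ fun _ => M)) ↔ IsArtinianRing S := by
  have hregS : ∀ a : S, ∃ x : S, a = a * x * a := fun a => by
    obtain ⟨b, rfl⟩ := hsurj a
    obtain ⟨x, hx⟩ := hreg b
    exact ⟨π x, by rw [← map_mul, ← map_mul, ← hx]⟩
  have hzero : ∀ a : R, π a = 0 ↔ ∀ m : M, a • m = 0 := fun a => by
    rw [← RingHom.mem_ker, hker, Module.mem_annihilator]
  constructor
  · intro h
    suffices IsNoetherianRing S from IsNoetherianRing.isArtinianRing_of_regular hregS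
    refine isNoetherian_iff_fg_wellFounded.2 ⟨RelEmbedding.wellFounded_iff_isEmpty.2 ⟨fun J => ?_⟩⟩
    have hJ : ∀ {n k}, n < k → (J n).1 < (J k).1 := fun hnk => J.map_rel_iff.2 hnk
    choose e heJ he using fun n => Ideal.FG.exists_right_identity hregS (J n).1 (J n).2
    choose c hc using fun n => hsurj (e n)
    have hne : ∀ n, ∃ x : M, (c (n + 1) * (1 - c n)) • x ≠ 0 := by
      intro n
      by_contra! hx
      have hx' := (hzero _).2 hx
      rw [map_mul, map_sub, map_one, hc, hc, mul_sub, mul_one, sub_eq_zero] at hx'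
      have hmem : e (n + 1) ∈ (J n).1 := hx' ▸ Ideal.mul_mem_left _ _ (heJ n)
      exact (hJ n.lt_succ_self).not_ge fun y hy =>
        he (n + 1) y hy ▸ Ideal.mul_mem_left _ _ hmem
    choose x hx using hne
    obtain ⟨n, hn⟩ := (h (ULift ℕ)).exists_smul_eq_zero Equiv.ulift (fun n => c (n + 1))
      (fun n => (1 - c n) • x n) fun n k hnk => by
        rw [← mul_smul]
        refine (hzero _).1 ?_ _
        have hle : (J (n + 1)).1 ≤ (J k).1 := by
          rcases (Nat.succ_le_of_lt hnk).eq_or_lt with rfl | hlt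
          · exact le_rfl
          · exact (hJ hlt).le
        rw [map_mul, map_sub, map_one, hc, hc, mul_sub, mul_one,
          he k _ (hle (heJ (n + 1))), sub_self]
    exact hx n (by rw [mul_smul, hn])
  · intro _ Λ I _ f
    obtain ⟨e, heI, he⟩ :=
      Ideal.FG.exists_right_identity hregS (I.map π) (IsNoetherian.noetherian _)
    obtain ⟨a, haI, rfl⟩ := (Ideal.mem_map_iff_of_surjective π hsurj).1 heI
    have hf : ∀ x : I, π x = 0 → f x = 0 := by
      intro x hx
      obtain ⟨y, hy⟩ := hreg x
      have hxy : x = ((x : R) * y) • x := Subtype.ext hy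
      rw [hxy, map_smul]
      refine DFinsupp.ext fun i => (DirectSum.smul_apply _ _ _).trans ?_
      exact (hzero _).1 (by rw [map_mul, hx, zero_mul]) _
    refine ⟨LinearMap.toSpanSingleton R _ (f ⟨a, haI⟩), fun x => ?_⟩
    rw [LinearMap.toSpanSingleton_apply, ← map_smul, eq_comm, ← sub_eq_zero, ← map_sub]
    refine hf _ ?_
    have := he _ (Ideal.mem_map_of_mem π x.2)
    simp [this]
end

section
/- Let F be a field, R a von Neumann regular F-algebra, and M an R-module whose dimension as an F-vector space is at most ℵ₀. Let I = Ann(M). Then the following are equivalent: (1) R/I is Artinian; (2) M is Σ-ℵ₀-injective; (3) M is ℵ₀-injective. -/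
universe u

/-- A von Neumann regular ring has trivial Jacobson radical, so it is semisimple as soon as it is
Artinian. -/
theorem isSemisimpleRing_of_regular {S : Type*} [Ring S] [IsArtinianRing S]
    (hreg : ∀ a : S, ∃ x : S, a = a * x * a) : IsSemisimpleRing S := by
  rw [IsArtinianRing.isSemisimpleRing_iff_jacobson, ← Ideal.jacobson_bot, eq_bot_iff]
  intro a ha
  obtain ⟨x, hx⟩ := hreg a
  obtain ⟨z, hz⟩ := Ideal.mem_jacobson_iff.1 ha (-x)
  rw [Ideal.mem_bot, sub_eq_zero] at hz
  rw [Ideal.mem_bot]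
  have hza : a * (z * -x * a + z) = a := by rw [hz, mul_one]
  have hl : (z * -x * a + z) * (x * a) = 0 := by
    have : z * x * a * x * a = z * x * a := by
      conv_rhs => rw [hx]
      noncomm_ring
    calc (z * -x * a + z) * (x * a) = z * x * a - z * x * a * x * a := by noncomm_ring
      _ = 0 := by rw [this, sub_self]
  rw [hz, one_mul] at hl
  rw [hx, mul_assoc, hl, mul_zero]

/-- A ring all of whose left ideals are generated by an idempotent is semisimple. -/
theorem isSemisimpleRing_of_forall_exists_idempotent {S : Type*} [Ring S]
    (h : ∀ L : Ideal S, ∃ e ∈ L, ∀ x ∈ L, x * e = x) : IsSemisimpleRing S := by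
  refine (isSemisimpleModule_iff S S).2 ⟨fun L => ?_⟩
  obtain ⟨e, he, hL⟩ := h L
  refine ⟨Ideal.span {1 - e}, ?_, ?_⟩
  · rw [Submodule.disjoint_def]
    intro x hx hx'
    obtain ⟨y, rfl⟩ := Ideal.mem_span_singleton'.1 hx'
    rw [← hL _ hx, mul_assoc, sub_mul, one_mul, hL e he, sub_self, mul_zero]
  · rw [codisjoint_iff, Ideal.eq_top_iff_one]
    exact Submodule.mem_sup.2 ⟨e, he, 1 - e, Ideal.mem_span_singleton_self _, by abel⟩

/-- In a von Neumann regular ring, an idempotent `e` of a left ideal `K` that does not generate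
`K` modulo `I` can be complemented by an orthogonal idempotent of `K` outside `I`. -/
theorem exists_orthogonal_idempotent {R : Type*} [Ring R]
    (hreg : ∀ a : R, ∃ x : R, a = a * x * a) {I K : Ideal R} {e x : R}
    (he : e * e = e) (heK : e ∈ K) (hx : x ∈ K) (hxI : x - x * e ∉ I) :
    ∃ h ∈ K, h ∉ I ∧ h * h = h ∧ e * h = 0 ∧ h * e = 0 := by
  obtain ⟨y, hy⟩ := hreg (x - x * e)
  set a := x - x * e with ha
  have haK : a ∈ K := K.sub_mem hx (K.mul_mem_left _ heK)
  have hae : a * e = 0 := by rw [ha, sub_mul, mul_assoc, he, sub_self]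
  have h1 : e * ((1 - e) * (y * a)) = 0 := by
    rw [← mul_assoc, mul_sub, mul_one, he, sub_self, zero_mul]
  have h2 : (1 - e) * (y * a) * e = 0 := by
    rw [mul_assoc, mul_assoc, hae, mul_zero, mul_zero]
  have h3 : a * ((1 - e) * (y * a)) = a := by
    rw [← mul_assoc, mul_sub, mul_one, hae, sub_zero, ← mul_assoc, ← hy]
  refine ⟨(1 - e) * (y * a), K.mul_mem_left _ (K.mul_mem_left _ haK), fun hI => hxI ?_, ?_, h1, h2⟩
  · rw [← h3]
    exact I.mul_mem_left _ hI
  · conv_lhs => rw [mul_assoc, mul_assoc, h3]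

/-- If every idempotent of the left ideal `K` has an orthogonal idempotent of `K` outside `I`, then
`K` contains an infinite sequence of pairwise orthogonal idempotents outside `I`. -/
theorem exists_seq_orthogonal_idempotents {R : Type*} [Ring R] {I K : Ideal R}
    (hK : ∀ e ∈ K, e * e = e → ∃ h ∈ K, h ∉ I ∧ h * h = h ∧ e * h = 0 ∧ h * e = 0) :
    ∃ h : ℕ → R, (∀ n, h n ∉ I) ∧ (∀ n, h n * h n = h n) ∧
      Pairwise fun m n => h m * h n = 0 := by
  choose g gK gI gg eg ge using hK
  let next : {e : R // e ∈ K ∧ e * e = e} → {e : R // e ∈ K ∧ e * e = e} := fun e =>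
    ⟨e.1 + g e.1 e.2.1 e.2.2, K.add_mem e.2.1 (gK ..), by
      rw [mul_add, add_mul, add_mul, eg, ge, gg, add_zero, zero_add]
      exact congrArg (· + _) e.2.2⟩
  let E : ℕ → {e : R // e ∈ K ∧ e * e = e} := fun n =>
    next^[n] ⟨0, K.zero_mem, mul_zero 0⟩
  let h : ℕ → R := fun n => g (E n).1 (E n).2.1 (E n).2.2
  have hh : ∀ n, h n * h n = h n := fun n => gg ..
  have Eh : ∀ n, (E n).1 * h n = 0 := fun n => eg ..
  have hE : ∀ n, h n * (E n).1 = 0 := fun n => ge ..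
  have Esucc : ∀ n, (E (n + 1)).1 = (E n).1 + h n := fun n => by
    simp only [E, Function.iterate_succ_apply']
    rfl
  have key : ∀ m n, m < n → h m * (E n).1 = h m ∧ (E n).1 * h m = h m := by
    intro m n hmn
    induction n, hmn using Nat.le_induction with
    | base => simp [Esucc, mul_add, add_mul, hE, Eh, hh]
    | succ n _ ih =>
      have e1 : h m * h n = 0 := by rw [← ih.1, mul_assoc, Eh, mul_zero]
      have e2 : h n * h m = 0 := by rw [← ih.2, ← mul_assoc, hE, zero_mul]
      simp [Esucc, mul_add, add_mul, ih.1, ih.2, e1, e2]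
  refine ⟨h, fun n => gI _ _ _, hh, fun m n hmn => ?_⟩
  rcases lt_or_gt_of_ne hmn with hlt | hlt
  · rw [← (key m n hlt).1, mul_assoc, Eh, mul_zero]
  · rw [← (key n m hlt).2, ← mul_assoc, hE, zero_mul]

/-- In an ℵ₀-injective module, countably many orthogonal idempotents can be assigned arbitrary
values simultaneously. -/
theorem Aleph0Injective.exists_forall_smul_eq {R M : Type*} [Ring R] [AddCommGroup M] [Module R M]
    (hM : Aleph0Injective R M) {h : ℕ → R} (horth : Pairwise fun m n => h m * h n = 0)
    {m : ℕ → M} (hm : ∀ n, h n • m n = m n) : ∃ x : M, ∀ n, h n • x = m n := by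
  have hne : ∀ k n, n ≠ k → h k • m n = 0 := fun k n hkn => by
    rw [← hm n, smul_smul, horth hkn.symm, zero_smul]
  have hfin : ∀ x ∈ Ideal.span (Set.range h), (Function.support fun n => x • m n).Finite := by
    intro x hx
    induction hx using Submodule.span_induction with
    | mem x hx =>
      obtain ⟨k, rfl⟩ := hx
      refine (Set.finite_singleton k).subset fun n hn => ?_
      by_contra hkn
      exact hn (hne k n hkn)
    | zero => simp
    | add x y _ _ hx hy =>
      refine (hx.union hy).subset fun n hn => ?_
      by_contra hcon
      simp only [Set.mem_union, Function.mem_support, not_or, not_not] at hcon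
      exact hn (by simp [add_smul, hcon.1, hcon.2])
    | smul r x _ hx =>
      refine hx.subset fun n hn hcon => hn ?_
      simp only at hcon
      simp [mul_smul, hcon]
  let f : Ideal.span (Set.range h) →ₗ[R] M :=
    { toFun := fun x => ∑ᶠ n, (x : R) • m n
      map_add' := fun x y => by
        simp only [Submodule.coe_add, add_smul]
        exact finsum_add_distrib (hfin x x.2) (hfin y y.2)
      map_smul' := fun r x => by
        simp only [Submodule.coe_smul, smul_eq_mul, mul_smul, RingHom.id_apply]
        exact (smul_finsum' r (hfin x x.2)).symm }
  obtain ⟨g, hg⟩ := hM _ ⟨_, Set.countable_range h, rfl⟩ f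
  refine ⟨g 1, fun n => ?_⟩
  have hgn := hg ⟨h n, Ideal.subset_span ⟨n, rfl⟩⟩
  rw [← map_smul, smul_eq_mul, mul_one]
  refine hgn.trans ?_
  change ∑ᶠ k, h n • m k = m n
  rw [finsum_eq_single _ n fun k hk => hne n k hk, hm]

/-- If `R ⧸ I` is semisimple, where `R` is von Neumann regular and `I` annihilates `M`, then `M` is
injective relative to every left ideal of `R`. -/
theorem exists_extension_of_isSemisimpleRing {R M S : Type*} [Ring R] [AddCommGroup M] [Module R M]
    [Ring S] [IsSemisimpleRing S] (hreg : ∀ a : R, ∃ x : R, a = a * x * a)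
    (π : R →+* S) (hsurj : Function.Surjective π)
    (hker : RingHom.ker π ≤ Module.annihilator R M) (J : Ideal R) (f : J →ₗ[R] M) :
    ∃ g : R →ₗ[R] M, ∀ x : J, g (x : R) = f x := by
  obtain ⟨e, he, hJ⟩ := IsSemisimpleRing.ideal_eq_span_idempotent (J.map π)
  have heJ : e ∈ J.map π := hJ ▸ Ideal.mem_span_singleton_self e
  obtain ⟨d, hd, rfl⟩ := (Ideal.mem_map_iff_of_surjective π hsurj).1 heJ
  refine ⟨LinearMap.toSpanSingleton R M (f ⟨d, hd⟩), fun x => ?_⟩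
  rw [LinearMap.toSpanSingleton_apply, ← map_smul, ← sub_eq_zero, ← map_sub]
  set z : J := (x : R) • ⟨d, hd⟩ - x with hz
  have hxe : π x * π d = π x := by
    have hx : π x ∈ J.map π := Ideal.mem_map_of_mem π x.2
    rw [hJ] at hx
    obtain ⟨s, hs⟩ := Ideal.mem_span_singleton'.1 hx
    rw [← hs, mul_assoc, he.eq]
  have hzI : π z = 0 := by
    simp [hz, hxe]
  obtain ⟨y, hy⟩ := hreg (z : R)
  have hzz : z = ((z : R) * y) • z := Subtype.ext hy
  rw [hzz, map_smul]
  refine Module.mem_annihilator.1 (hker ?_) _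
  rw [RingHom.mem_ker, map_mul, hzI, zero_mul]

/-- An ℵ₀-injective module over an `F`-algebra on which infinitely many orthogonal idempotents act
nontrivially has uncountable `F`-dimension. -/
theorem Aleph0Injective.aleph0_lt_rank {F R M : Type u} [Field F] [Ring R] [Algebra F R]
    [AddCommGroup M] [Module R M] [Module F M] [IsScalarTower F R M]
    (hM : Aleph0Injective R M) {h : ℕ → R} (hidem : ∀ n, h n * h n = h n)
    (horth : Pairwise fun m n => h m * h n = 0) (hne : ∀ n, h n ∉ Module.annihilator R M) :
    Cardinal.aleph0 < Module.rank F M := by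
  have hne' : ∀ n, ∃ x : M, h n • x ≠ 0 := fun n => by
    simpa [Module.mem_annihilator] using hne n
  choose x hx using hne'
  have hφ : ∀ n, ∃ φ : Module.Dual F M, φ (h n • x n) ≠ 0 := fun n => by
    by_contra! hcon
    exact hx n ((Module.forall_dual_apply_eq_zero_iff F _).1 hcon)
  choose φ hφ using hφ
  have : SMulCommClass F R M := IsScalarTower.to_smulCommClass
  let T : M →ₗ[F] (ℕ → F) :=
    LinearMap.pi fun n => (φ n).comp (Algebra.lsmul F F M (h n))
  have hT : Function.Surjective T := by
    intro c
    obtain ⟨y, hy⟩ := hM.exists_forall_smul_eq horth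
      (m := fun n => (c n / φ n (h n • x n)) • h n • x n) fun n => by
        rw [smul_comm, smul_smul (h n), hidem]
    refine ⟨y, funext fun n => ?_⟩
    change φ n (h n • y) = c n
    rw [hy, map_smul, smul_eq_mul, div_mul_cancel₀ _ (hφ n)]
  refine lt_of_lt_of_le ?_ (LinearMap.rank_le_of_surjective T hT)
  rw [rank_fun_infinite, Cardinal.mk_arrow, Cardinal.mk_nat, Cardinal.lift_aleph0,
    Cardinal.lift_id'.{0, u}]
  exact (Cardinal.cantor _).trans_le (Cardinal.power_le_power_right
    (Cardinal.two_le_iff.2 ⟨0, 1, zero_ne_one⟩))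

/-- Let `F` be a field, `R` a von Neumann regular `F`-algebra, and `M` an `R`-module whose
`F`-dimension is at most `ℵ₀`; let `I = Ann(M)`.  The quotient ring `R/I` is encoded as a
ring `S` with a surjective ring homomorphism `π : R →+* S` with kernel `I`.  Then the
following are equivalent: (1) `R/I` is Artinian; (2) `M` is Σ-ℵ₀-injective; (3) `M` is
ℵ₀-injective. -/
theorem regular_algebra_aleph0Injective_tfae (F : Type u) [Field F]
    (R : Type u) [Ring R] [Algebra F R]
    (hreg : ∀ a : R, ∃ x : R, a = a * x * a)
    (M : Type u) [AddCommGroup M] [Module R M] [Module F M] [IsScalarTower F R M]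
    (hdim : Module.rank F M ≤ Cardinal.aleph0)
    (S : Type u) [Ring S] (π : R →+* S) (hsurj : Function.Surjective π)
    (hker : RingHom.ker π = Module.annihilator R M) :
    List.TFAE
      [ IsArtinianRing S,
        ∀ Λ : Type u, Aleph0Injective R (DirectSum Λ fun _ => M),
        Aleph0Injective R M ] := by
  tfae_have 1 → 2 := fun _ Λ J _ f => by
    have hregS : ∀ a : S, ∃ x : S, a = a * x * a := fun a => by
      obtain ⟨a, rfl⟩ := hsurj a
      obtain ⟨x, hx⟩ := hreg a
      exact ⟨π x, by rw [← map_mul, ← map_mul, ← hx]⟩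
    have := isSemisimpleRing_of_regular hregS
    refine exists_extension_of_isSemisimpleRing hreg π hsurj (fun r hr => ?_) J f
    rw [hker, Module.mem_annihilator] at hr
    refine Module.mem_annihilator.2 fun v => DFinsupp.ext fun i => ?_
    exact hr (v i)
  tfae_have 2 → 3 := fun h J hJ f => by
    let e := DirectSum.lid R M PUnit.{u + 1}
    obtain ⟨g, hg⟩ := h PUnit J hJ (e.symm.toLinearMap.comp f)
    exact ⟨e.toLinearMap.comp g, fun x => by simp [hg]⟩
  tfae_have 3 → 1 := fun hM => by
    suffices IsSemisimpleRing S from inferInstance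
    refine isSemisimpleRing_of_forall_exists_idempotent fun L => ?_
    by_contra! hL
    obtain ⟨h, hI, hidem, horth⟩ := exists_seq_orthogonal_idempotents
      (I := Module.annihilator R M) (K := L.comap π) fun e he hee => by
        obtain ⟨s, hs, hse⟩ := hL (π e) he
        obtain ⟨x, rfl⟩ := hsurj s
        refine exists_orthogonal_idempotent hreg hee he (x := x) hs fun hxI => hse ?_
        rw [← hker, RingHom.mem_ker, map_sub, map_mul, sub_eq_zero] at hxI
        exact hxI.symm
    exact (hM.aleph0_lt_rank (F := F) hidem horth hI).not_ge hdim
  tfae_finish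
end

section
/- Let R be an ℵ₀-self-injective von Neumann regular ring and let P be a finitely generated projective R-module. Then P is ℵ₀-quasi-injective: every R-linear map from a countably generated submodule of P into P extends to an R-linear endomorphism of P. -/
universe u

/-- A finitely generated left ideal of a von Neumann regular ring has a right identity. -/
theorem Ideal.exists_mem_forall_mul_eq_of_fg {R : Type*} [Ring R]
    (hreg : ∀ a : R, ∃ x : R, a = a * x * a) {J : Ideal R} (hJ : J.FG) :
    ∃ e ∈ J, ∀ x ∈ J, x * e = x := by
  classical
  obtain ⟨s, rfl⟩ := hJ
  induction s using Finset.induction_on with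
  | empty => exact ⟨0, by simp, by simp⟩
  | insert a s _ ih =>
    obtain ⟨e, heJ, he⟩ := ih
    obtain ⟨y, hy⟩ := hreg (a - a * e)
    have hee : e * e = e := he e heJ
    have hle : Ideal.span (s : Set R) ≤ Ideal.span ((insert a s : Finset R) : Set R) :=
      Ideal.span_mono (by simp)
    have ha : a ∈ Ideal.span ((insert a s : Finset R) : Set R) :=
      Ideal.subset_span (by simp)
    have hg : y * (a - a * e) ∈ Ideal.span ((insert a s : Finset R) : Set R) :=
      Ideal.mul_mem_left _ _ (sub_mem ha (Ideal.mul_mem_left _ _ (hle heJ)))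
    refine ⟨e + y * (a - a * e) - e * (y * (a - a * e)),
      sub_mem (add_mem (hle heJ) hg) (Ideal.mul_mem_left _ _ hg), fun x hx => ?_⟩
    have hxs : ∀ z ∈ Ideal.span (s : Set R),
        z * (e + y * (a - a * e) - e * (y * (a - a * e))) = z := fun z hz => by
      rw [mul_sub, mul_add, ← mul_assoc z e, he z hz, add_sub_cancel_right]
    rw [Finset.coe_insert, Ideal.mem_span_insert] at hx
    obtain ⟨r, z, hz, rfl⟩ := hx
    have hb : (a - a * e) * e = 0 := by rw [sub_mul, mul_assoc, hee, sub_self]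
    have hba : (a - a * e) * (e + y * (a - a * e) - e * (y * (a - a * e))) = a - a * e := by
      rw [mul_sub, mul_add, ← mul_assoc _ e, hb, zero_mul, sub_zero, zero_add, ← mul_assoc,
        ← hy]
    have haa : a * (e + y * (a - a * e) - e * (y * (a - a * e))) = a := by
      have h := hxs (a * e) (Ideal.mul_mem_left _ _ heJ)
      rw [sub_mul, h] at hba
      exact sub_left_injective hba
    rw [add_mul, hxs z hz, mul_assoc, haa]

/-- Over a von Neumann regular ring, the kernel of a functional on a finitely generated module
is finitely generated. -/
theorem Submodule.FG.inf_ker {R N : Type*} [Ring R] [AddCommGroup N] [Module R N]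
    (hreg : ∀ a : R, ∃ x : R, a = a * x * a) {F : Submodule R N} (hF : F.FG) (φ : N →ₗ[R] R) :
    (F ⊓ LinearMap.ker φ).FG := by
  obtain ⟨_, ⟨v, hv, rfl⟩, he⟩ := Ideal.exists_mem_forall_mul_eq_of_fg hreg (hF.map φ)
  have : F ⊓ LinearMap.ker φ = F.map (LinearMap.id - φ.smulRight v) := by
    ext x
    constructor
    · rintro ⟨hx, hx0⟩
      exact ⟨x, hx, by simp [LinearMap.mem_ker.mp hx0]⟩
    · rintro ⟨z, hz, rfl⟩
      exact ⟨sub_mem hz (F.smul_mem _ hv),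
        by simp [he _ (Submodule.mem_map_of_mem hz)]⟩
  exact this ▸ hF.map _

/-- Over a von Neumann regular ring, the kernel of a functional on a countably generated
module is countably generated. -/
theorem exists_countable_span_eq_inf_ker {R N : Type*} [Ring R] [AddCommGroup N] [Module R N]
    (hreg : ∀ a : R, ∃ x : R, a = a * x * a) {B : Submodule R N}
    (hB : ∃ s : Set N, s.Countable ∧ Submodule.span R s = B) (φ : N →ₗ[R] R) :
    ∃ s : Set N, s.Countable ∧ Submodule.span R s = B ⊓ LinearMap.ker φ := by
  obtain ⟨s, hs, rfl⟩ := hB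
  have hfg (t : Finset N) : (Submodule.span R (t : Set N) ⊓ LinearMap.ker φ).FG :=
    Submodule.FG.inf_ker hreg ⟨t, rfl⟩ φ
  choose G hG using hfg
  have hc : {t : Finset N | (t : Set N) ⊆ s}.Countable := by
    refine Set.Countable.mono (fun t ht => ?_)
      ((Set.countable_ofPred_finite_subset hs).preimage (Finset.coe_injective (α := N)))
    exact ⟨t.finite_toSet, ht⟩
  refine ⟨⋃ t ∈ {t : Finset N | (t : Set N) ⊆ s}, (G t : Set N),
    hc.biUnion fun t _ => (G t).countable_toSet, le_antisymm ?_ ?_⟩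
  · simp only [Submodule.span_iUnion, hG]
    exact iSup₂_le fun t ht => inf_le_inf_right _ (Submodule.span_mono ht)
  · rintro x ⟨hx, hx0⟩
    obtain ⟨t, ht, hxt⟩ := Submodule.mem_span_finite_of_mem_span hx
    have hxG : x ∈ Submodule.span R (G t : Set N) := hG t ▸ ⟨hxt, hx0⟩
    exact Submodule.span_mono
      (Set.subset_biUnion_of_mem (u := fun t => (G t : Set N))
        (show t ∈ {t : Finset N | (t : Set N) ⊆ s} from ht)) hxG

/-- A map from a countably generated submodule into an ℵ₀-injective module that vanishes on the
kernel of a functional factors through that functional. -/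
theorem Aleph0Injective.exists_factor_functional {R M N : Type*} [Ring R]
    [AddCommGroup M] [Module R M] [AddCommGroup N] [Module R N] (hM : Aleph0Injective R M)
    {B : Submodule R N} (hB : ∃ s : Set N, s.Countable ∧ Submodule.span R s = B)
    (φ : N →ₗ[R] R) (f : B →ₗ[R] M) (hf : ∀ x : B, φ x = 0 → f x = 0) :
    ∃ g : R →ₗ[R] M, ∀ x : B, g (φ x) = f x := by
  let ψ : B →ₗ[R] R := φ ∘ₗ B.subtype
  have hI : IdealCountablyGenerated (LinearMap.range ψ) := by
    obtain ⟨s, hs, rfl⟩ := hB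
    refine ⟨φ '' s, hs.image _, ?_⟩
    rw [LinearMap.range_comp, Submodule.range_subtype, Submodule.map_span]
  have hker : LinearMap.ker ψ ≤ LinearMap.ker f := fun x hx => hf x hx
  obtain ⟨g, hg⟩ := hM _ hI
    ((LinearMap.ker ψ).liftQ f hker ∘ₗ ψ.quotKerEquivRange.symm.toLinearMap)
  refine ⟨g, fun x => (hg ⟨ψ x, x, rfl⟩).trans ?_⟩
  have : ψ.quotKerEquivRange.symm ⟨ψ x, x, rfl⟩ = (LinearMap.ker ψ).mkQ x :=
    ψ.quotKerEquivRange_symm_apply_image x _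
  simp [this]

/-- Over a von Neumann regular ring, a map from a countably generated submodule into an
ℵ₀-injective module that vanishes on the common kernel of finitely many functionals factors
through these functionals. -/
theorem Aleph0Injective.exists_factor_pi {R M N : Type*} [Ring R]
    [AddCommGroup M] [Module R M] [AddCommGroup N] [Module R N]
    (hreg : ∀ a : R, ∃ x : R, a = a * x * a) (hM : Aleph0Injective R M) (n : ℕ)
    {B : Submodule R N} (hB : ∃ s : Set N, s.Countable ∧ Submodule.span R s = B)
    (φ : N →ₗ[R] (Fin n → R)) (f : B →ₗ[R] M) (hf : ∀ x : B, φ x = 0 → f x = 0) :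
    ∃ g : (Fin n → R) →ₗ[R] M, ∀ x : B, g (φ x) = f x := by
  induction n generalizing B with
  | zero => exact ⟨0, fun x => (hf x (Subsingleton.elim _ _)).symm⟩
  | succ n ih =>
    let tail : (Fin (n + 1) → R) →ₗ[R] (Fin n → R) := LinearMap.funLeft R R Fin.succ
    let head : (Fin (n + 1) → R) →ₗ[R] R := LinearMap.proj 0
    obtain ⟨h, hh⟩ := ih (exists_countable_span_eq_inf_ker hreg hB (head ∘ₗ φ)) (tail ∘ₗ φ)
      (f ∘ₗ Submodule.inclusion inf_le_left) fun x hx => hf _ <| by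
        ext i
        exact i.cases x.2.2 fun j => congrFun hx j
    obtain ⟨g, hg⟩ := hM.exists_factor_functional hB (head ∘ₗ φ)
      (f - (h ∘ₗ tail ∘ₗ φ) ∘ₗ B.subtype)
      fun x hx => sub_eq_zero.mpr (hh ⟨x, x.2, hx⟩).symm
    exact ⟨g ∘ₗ head + h ∘ₗ tail, fun x => eq_sub_iff_add_eq.mp (hg x)⟩

/-- A finitely generated projective module over an ℵ₀-self-injective ring is ℵ₀-injective. -/
theorem Aleph0Injective.of_fg_projective {R P : Type*} [Ring R] (hinj : Aleph0Injective R R)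
    [AddCommGroup P] [Module R P] [Module.Finite R P] [Module.Projective R P] :
    Aleph0Injective R P := by
  intro I hI f
  obtain ⟨n, p, i, -, -, hpi⟩ := Module.Finite.exists_comp_eq_id_of_projective R P
  choose g hg using fun j => hinj I hI (LinearMap.proj j ∘ₗ i ∘ₗ f)
  refine ⟨p ∘ₗ LinearMap.pi g, fun x => ?_⟩
  have : LinearMap.pi g (x : R) = i (f x) := funext fun j => hg j x
  rw [LinearMap.comp_apply, this, ← LinearMap.comp_apply, hpi, LinearMap.id_apply]

/-- Let `R` be an ℵ₀-self-injective von Neumann regular ring and `P` a finitely generated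
projective `R`-module.  Then `P` is ℵ₀-quasi-injective: every `R`-linear map from a
countably generated submodule of `P` into `P` extends to an endomorphism of `P`. -/
theorem aleph0QuasiInjective_of_fg_projective (R : Type u) [Ring R]
    (hreg : ∀ a : R, ∃ x : R, a = a * x * a)
    (hinj : Aleph0Injective R R)
    (P : Type u) [AddCommGroup P] [Module R P] [Module.Finite R P] [Module.Projective R P] :
    ∀ B : Submodule R P, (∃ s : Set P, s.Countable ∧ Submodule.span R s = B) →
      ∀ f : B →ₗ[R] P, ∃ g : P →ₗ[R] P, ∀ x : B, g (x : P) = f x := by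
  obtain ⟨n, p, i, -, hi, -⟩ := Module.Finite.exists_comp_eq_id_of_projective R P
  intro B hB f
  obtain ⟨g, hg⟩ := hinj.of_fg_projective.exists_factor_pi hreg n hB i f fun x hx => by
    have hx0 : x = 0 := Subtype.ext (hi (hx.trans (map_zero i).symm))
    rw [hx0, map_zero]
  exact ⟨g ∘ₗ i, hg⟩
end

section
/- Let M be a quasi-injective R-module. Then M is Dedekind-finite (for every R-module N, if M ⊕ N is isomorphic to M then N = 0) if and only if M is co-hopfian (every injective R-linear endomorphism of M is surjective). -/
universe u

/-- Let `M` be a quasi-injective `R`-module.  Then `M` is Dedekind-finite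
(`M ⊕ N ≅ M` implies `N = 0`) iff `M` is co-hopfian (every injective endomorphism of `M`
is surjective). -/
theorem quasiInjective_dedekindFinite_iff_coHopfian (R : Type u) [Ring R]
    (M : Type u) [AddCommGroup M] [Module R M]
    (hqi : ∀ B : Submodule R M, ∀ f : B →ₗ[R] M, ∃ g : M →ₗ[R] M, ∀ x : B, g (x : M) = f x) :
    (∀ (N : Type u) [AddCommGroup N] [Module R N],
        Nonempty ((M × N) ≃ₗ[R] M) → Subsingleton N) ↔
      ∀ f : M →ₗ[R] M, Function.Injective f → Function.Surjective f := by
  constructor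
  · intro h f hf
    obtain ⟨g, hg⟩ := hqi (LinearMap.range f) (LinearEquiv.ofInjective f hf).symm
    have hgf (x : M) : g (f x) = x :=
      (hg (LinearEquiv.ofInjective f hf x)).trans
        ((LinearEquiv.ofInjective f hf).symm_apply_apply x)
    let φ : (M × LinearMap.ker g) →ₗ[R] M := f.coprod (LinearMap.ker g).subtype
    have hφ (p : M × LinearMap.ker g) : φ p = f p.1 + p.2 := rfl
    have hmem (y : M) : y - f (g y) ∈ LinearMap.ker g := by
      rw [LinearMap.mem_ker, map_sub, hgf, sub_self]
    have hbij : Function.Bijective φ := by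
      refine ⟨(injective_iff_map_eq_zero φ).2 fun p hp => ?_,
        fun y => ⟨(g y, ⟨y - f (g y), hmem y⟩), by simp [hφ]⟩⟩
      rw [hφ] at hp
      have h₁ : p.1 = 0 := by
        have hgp := congrArg g hp
        rwa [map_add, hgf, LinearMap.mem_ker.1 p.2.2, add_zero, map_zero] at hgp
      refine Prod.ext h₁ (Subtype.ext ?_)
      rwa [h₁, map_zero, zero_add] at hp
    have hsub := h (LinearMap.ker g) ⟨LinearEquiv.ofBijective φ hbij⟩
    intro y
    have hy : (⟨y - f (g y), hmem y⟩ : LinearMap.ker g) = 0 := Subsingleton.elim _ _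
    exact ⟨g y, (sub_eq_zero.1 (congrArg Subtype.val hy)).symm⟩
  · rintro h N _ _ ⟨e⟩
    have hsurj := h (e.toLinearMap ∘ₗ LinearMap.inl R M N)
      (e.injective.comp LinearMap.inl_injective)
    refine subsingleton_of_forall_eq 0 fun n => ?_
    obtain ⟨x, hx⟩ := hsurj (e (0, n))
    exact (congrArg Prod.snd (e.injective hx)).symm
end

section
/- Let R be a ring and K a two-sided ideal of R. If R is an ℵ₀-qc ring, then the quotient ring R/K is an ℵ₀-qc ring. -/
/-- `M` is an ℵ₀-quasi-injective module over `S`. -/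
def Aleph0QuasiInjective (S M : Type*) [Ring S] [AddCommGroup M] [Module S M] : Prop :=
  ∀ B : Submodule S M, (∃ s : Set M, s.Countable ∧ Submodule.span S s = B) →
    ∀ f : B →ₗ[S] M, ∃ g : M →ₗ[S] M, ∀ x : B, g (x : M) = f x

universe u

/-- `S` is an ℵ₀-qc ring: every cyclic `S`-module is ℵ₀-quasi-injective. -/
def Aleph0QCRing (S : Type u) [Ring S] : Prop :=
  ∀ (N : Type u) [AddCommGroup N] [Module S N],
    (∃ x : N, Submodule.span S {x} = ⊤) → Aleph0QuasiInjective S N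

/-- Along a surjective ring homomorphism `π : R →+* S`, the `R`-span and the `S`-span of a set
in an `S`-module (viewed as an `R`-module through `π`) have the same elements. -/
theorem mem_span_iff_of_surjective {R S N : Type*} [Ring R] [Ring S] [AddCommGroup N]
    [Module R N] [Module S N] (π : R →+* S) (hsurj : Function.Surjective π)
    (hπ : ∀ (r : R) (x : N), r • x = π r • x) (s : Set N) (x : N) :
    x ∈ Submodule.span R s ↔ x ∈ Submodule.span S s := by
  constructor <;> intro hx
  · induction hx using Submodule.span_induction with
    | mem x h => exact Submodule.subset_span h
    | zero => exact zero_mem _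
    | add x y _ _ hx hy => exact add_mem hx hy
    | smul r x _ hx => exact hπ r x ▸ Submodule.smul_mem _ _ hx
  · induction hx using Submodule.span_induction with
    | mem x h => exact Submodule.subset_span h
    | zero => exact zero_mem _
    | add x y _ _ hx hy => exact add_mem hx hy
    | smul a x _ hx =>
      obtain ⟨r, rfl⟩ := hsurj a
      exact hπ r x ▸ Submodule.smul_mem _ r hx

/-- If `R` is an ℵ₀-qc ring then so is any quotient ring `R/K`, encoded as a ring `S`
together with a surjective ring homomorphism `π : R →+* S`. -/
theorem aleph0QCRing_quotient (R S : Type u) [Ring R] [Ring S]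
    (π : R →+* S) (hsurj : Function.Surjective π)
    (hR : Aleph0QCRing R) : Aleph0QCRing S := by
  intro N _ _ ⟨x, hx⟩ B ⟨s, hs, hsB⟩ f
  let _ : Module R N := Module.compHom N π
  have hπ : ∀ (r : R) (y : N), r • y = π r • y := fun _ _ => rfl
  have hspan := mem_span_iff_of_surjective (N := N) π hsurj hπ
  have hcyclic : Submodule.span R {x} = ⊤ :=
    Submodule.eq_top_iff'.2 fun y => (hspan {x} y).2 (hx ▸ Submodule.mem_top)
  have hB : ∀ y, y ∈ Submodule.span R s ↔ y ∈ B := fun y => hsB ▸ hspan s y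
  let f' : Submodule.span R s →ₗ[R] N :=
    { toFun := fun y => f ⟨y, (hB y).1 y.2⟩
      map_add' := fun y z => f.map_add ⟨y, (hB y).1 y.2⟩ ⟨z, (hB z).1 z.2⟩
      map_smul' := fun r y => f.map_smul (π r) ⟨y, (hB y).1 y.2⟩ }
  obtain ⟨g, hg⟩ := hR N ⟨x, hcyclic⟩ (Submodule.span R s) ⟨s, hs, rfl⟩ f'
  refine ⟨{ toFun := g, map_add' := g.map_add, map_smul' := fun a y => ?_ },
    fun y => hg ⟨y, (hB y).2 y.2⟩⟩
  obtain ⟨r, rfl⟩ := hsurj a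
  exact g.map_smul r y
end

section
/- Let F be a field of characteristic 0 and G a group. Then the following are equivalent: (1) the group algebra F[G] is ℵ₀-self-injective; (2) G is finite; (3) F[G] is self-injective (injective as a module over itself). -/
universe u

/-- Over an `ℵ₀`-self-injective ring, a countable family of linear equations `x i * c = y i` is
solvable as soon as it is consistent with the left linear relations among the `x i`. -/
theorem Aleph0Injective.exists_mul_eq {R : Type*} [Ring R] (hR : Aleph0Injective R R)
    {ι : Type*} [Countable ι] (x y : ι → R)
    (hxy : ∀ r : ι →₀ R, Finsupp.linearCombination R x r = 0 →
      Finsupp.linearCombination R y r = 0) :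
    ∃ c : R, ∀ i, x i * c = y i := by
  let φ := Finsupp.linearCombination R x
  let ψ := Finsupp.linearCombination R y
  have hle : LinearMap.ker φ ≤ LinearMap.ker ψ := fun r hr => hxy r hr
  let f : LinearMap.range φ →ₗ[R] R :=
    (LinearMap.ker φ).liftQ ψ hle ∘ₗ φ.quotKerEquivRange.symm.toLinearMap
  obtain ⟨g, hg⟩ := hR (LinearMap.range φ)
    ⟨Set.range x, Set.countable_range x, (Finsupp.range_linearCombination R).symm⟩ f
  refine ⟨g 1, fun i => ?_⟩
  have hx : φ (Finsupp.single i 1) = x i := by simp [φ]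
  have hmem : x i ∈ LinearMap.range φ := ⟨_, hx⟩
  have hsymm : φ.quotKerEquivRange.symm ⟨x i, hmem⟩ =
      (LinearMap.ker φ).mkQ (Finsupp.single i 1) := by
    rw [LinearEquiv.symm_apply_eq]
    exact Subtype.ext hx.symm
  calc x i * g 1 = g (x i) := by rw [← smul_eq_mul, ← map_smul, smul_eq_mul, mul_one]
    _ = f ⟨x i, hmem⟩ := hg ⟨x i, hmem⟩
    _ = y i := by
      change (LinearMap.ker φ).liftQ ψ hle (φ.quotKerEquivRange.symm ⟨x i, hmem⟩) = y i
      rw [hsymm]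
      simp [ψ]

namespace MonoidAlgebra

variable {F G : Type*} [Field F] [Group G]

/-- An element of a group algebra fixed by right multiplication by infinitely many group elements
vanishes. -/
theorem eq_zero_of_mul_single_eq_self {S : Set G} (hS : S.Infinite) {z : MonoidAlgebra F G}
    (hz : ∀ h ∈ S, z * single h 1 = z) : z = 0 := by
  ext g
  by_contra hg
  refine hS ((z.coeff.support.finite_toSet.preimage
    (f := fun h : G => g * h⁻¹) (by intro a _ b _ hab; simpa using hab)).subset fun h hh => ?_)
  have := congrArg (fun w => w.coeff g) (hz h hh)
  simp only [coeff_mul_single_apply, mul_one] at this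
  simpa [this] using hg

/-- The group elements fixing `z` by right multiplication. -/
def rightStabilizer (z : MonoidAlgebra F G) : Subgroup G where
  carrier := {h | z * single h 1 = z}
  one_mem' := by
    change z * 1 = z
    exact mul_one z
  mul_mem' {a b} ha hb := by
    have hab : (single (a * b) 1 : MonoidAlgebra F G) = single a 1 * single b 1 := by
      rw [single_mul_single, mul_one]
    change z * single (a * b) 1 = z
    rw [hab, ← mul_assoc, show z * single a 1 = z from ha, show z * single b 1 = z from hb]
  inv_mem' {a} ha := by
    change z * single a⁻¹ 1 = z
    conv_lhs => rw [← show z * single a 1 = z from ha]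
    rw [mul_assoc, single_mul_single, mul_inv_cancel, mul_one, ← one_def, mul_one]

theorem mem_rightStabilizer {z : MonoidAlgebra F G} {h : G} :
    h ∈ rightStabilizer z ↔ z * single h 1 = z := Iff.rfl

theorem eq_zero_of_le_rightStabilizer {K : Subgroup G} [Infinite K] {z : MonoidAlgebra F G}
    (hz : K ≤ rightStabilizer z) : z = 0 :=
  eq_zero_of_mul_single_eq_self (Set.infinite_coe_iff.mp ‹Infinite K›) fun _ hh => hz hh

variable (F G) in
/-- The augmentation map of a group algebra. -/
noncomputable def augmentation : MonoidAlgebra F G →ₐ[F] F := lift F F G 1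

theorem augmentation_single (g : G) (a : F) : augmentation F G (single g a) = a := by
  simp [augmentation]

variable (F) in
/-- The average of the elements of a finite subgroup, as an element of the group algebra. -/
noncomputable def subgroupAverage (H : Subgroup G) : MonoidAlgebra F G :=
  (Nat.card H : F)⁻¹ • ∑ᶠ h : H, single (h : G) 1

theorem natCard_subgroup_ne_zero [CharZero F] (H : Subgroup G) [Finite H] :
    (Nat.card H : F) ≠ 0 :=
  Nat.cast_ne_zero.mpr Nat.card_pos.ne'

section

variable [CharZero F] (H : Subgroup G) [Finite H]

theorem subgroupAverage_mul {z : MonoidAlgebra F G} (hz : ∀ h ∈ H, single h 1 * z = z) :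
    subgroupAverage F H * z = z := by
  have := Fintype.ofFinite H
  rw [subgroupAverage, finsum_eq_sum_of_fintype, smul_mul_assoc, Finset.sum_mul,
    Finset.sum_congr rfl fun (h : H) _ => hz h h.2, Finset.sum_const, Finset.card_univ,
    ← Nat.card_eq_fintype_card, ← Nat.cast_smul_eq_nsmul F, smul_smul,
    inv_mul_cancel₀ (natCard_subgroup_ne_zero H), one_smul]

theorem mul_subgroupAverage {z : MonoidAlgebra F G} (hz : ∀ h ∈ H, z * single h 1 = z) :
    z * subgroupAverage F H = z := by
  have := Fintype.ofFinite H
  rw [subgroupAverage, finsum_eq_sum_of_fintype, mul_smul_comm, Finset.mul_sum,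
    Finset.sum_congr rfl fun (h : H) _ => hz h h.2, Finset.sum_const, Finset.card_univ,
    ← Nat.card_eq_fintype_card, ← Nat.cast_smul_eq_nsmul F, smul_smul,
    inv_mul_cancel₀ (natCard_subgroup_ne_zero H), one_smul]

theorem augmentation_subgroupAverage : augmentation F G (subgroupAverage F H) = 1 := by
  have := Fintype.ofFinite H
  rw [subgroupAverage, finsum_eq_sum_of_fintype, map_smul, map_sum,
    Finset.sum_congr rfl fun (h : H) _ => augmentation_single (h : G) 1, Finset.sum_const,
    Finset.card_univ, ← Nat.card_eq_fintype_card, nsmul_eq_mul, mul_one, smul_eq_mul,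
    inv_mul_cancel₀ (natCard_subgroup_ne_zero H)]

end

section

variable {H : Subgroup G} [Finite H]

theorem single_mul_subgroupAverage {h : G} (hh : h ∈ H) :
    single h 1 * subgroupAverage F H = subgroupAverage F H := by
  have := Fintype.ofFinite H
  rw [subgroupAverage, finsum_eq_sum_of_fintype, mul_smul_comm, Finset.mul_sum]
  congr 1
  refine Fintype.sum_equiv (Equiv.mulLeft (⟨h, hh⟩ : H)) _ _ fun k => ?_
  simp [single_mul_single]

theorem subgroupAverage_mul_single {h : G} (hh : h ∈ H) :
    subgroupAverage F H * single h 1 = subgroupAverage F H := by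
  have := Fintype.ofFinite H
  rw [subgroupAverage, finsum_eq_sum_of_fintype, smul_mul_assoc, Finset.sum_mul]
  congr 1
  refine Fintype.sum_equiv (Equiv.mulRight (⟨h, hh⟩ : H)) _ _ fun k => ?_
  simp [single_mul_single]

theorem le_rightStabilizer_mul_subgroupAverage (r : MonoidAlgebra F G) :
    H ≤ rightStabilizer (r * subgroupAverage F H) := fun h hh => by
  rw [mem_rightStabilizer, mul_assoc, subgroupAverage_mul_single hh]

open Classical in
theorem coeff_subgroupAverage_mul_single (g : G) (a : F) :
    (subgroupAverage F H * single g a).coeff 1 =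
      if g ∈ H then a * (Nat.card H : F)⁻¹ else 0 := by
  have := Fintype.ofFinite H
  rw [coeff_mul_single_apply, subgroupAverage, finsum_eq_sum_of_fintype, coeff_smul_apply,
    coeff_sum, Finsupp.finsetSum_apply, one_mul]
  simp only [coeff_single, Finsupp.single_apply]
  split_ifs with hg
  · rw [Finset.sum_eq_single (⟨g⁻¹, H.inv_mem hg⟩ : H)]
    · simp [mul_comm]
    · intro b _ hb
      exact if_neg fun h => hb (Subtype.ext h)
    · simp
  · rw [Finset.sum_eq_zero]
    · simp
    · intro b _
      exact if_neg fun h => hg (by simpa [h] using b.2)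

end

section

variable [CharZero F] {H K : Subgroup G} [Finite H] [Finite K]

theorem subgroupAverage_mul_subgroupAverage_of_le (h : H ≤ K) :
    subgroupAverage F H * subgroupAverage F K = subgroupAverage F K :=
  subgroupAverage_mul H fun _ hk => single_mul_subgroupAverage (h hk)

theorem subgroupAverage_mul_subgroupAverage_of_ge (h : K ≤ H) :
    subgroupAverage F H * subgroupAverage F K = subgroupAverage F H :=
  mul_subgroupAverage K fun _ hk => subgroupAverage_mul_single (h hk)

end

/-- If the group algebra is `ℵ₀`-self-injective, the group is torsion. -/
theorem isOfFinOrder_of_aleph0Injective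
    (hR : Aleph0Injective (MonoidAlgebra F G) (MonoidAlgebra F G)) (g : G) :
    IsOfFinOrder g := by
  by_contra hg
  have : Infinite (Subgroup.zpowers g) := infinite_zpowers.mpr hg |>.to_subtype
  obtain ⟨c, hc⟩ := hR.exists_mul_eq (fun _ : Unit => 1 - single g 1) (fun _ => 1) fun r hr => by
    have hr0 : r () * (1 - single g 1) = 0 := by
      simpa [Finsupp.linearCombination_unique] using hr
    have : r () = 0 := eq_zero_of_le_rightStabilizer (K := Subgroup.zpowers g) <| by
      rw [Subgroup.zpowers_le, mem_rightStabilizer]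
      rw [mul_sub, mul_one, sub_eq_zero] at hr0
      exact hr0.symm
    simp [Finsupp.linearCombination_unique, this]
  have := congrArg (augmentation F G) (hc ())
  simp [augmentation_single] at this

/-- If the group algebra is `ℵ₀`-self-injective in characteristic zero, the join of two finite
subgroups is finite. -/
theorem finite_sup_of_aleph0Injective [CharZero F]
    (hR : Aleph0Injective (MonoidAlgebra F G) (MonoidAlgebra F G))
    (H K : Subgroup G) [Finite H] [Finite K] : Finite (H ⊔ K : Subgroup G) := by
  by_contra hfin
  have : Infinite (H ⊔ K : Subgroup G) := not_finite_iff_infinite.mp hfin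
  obtain ⟨c, hc⟩ := hR.exists_mul_eq
      (fun b : Bool => if b then subgroupAverage F H else subgroupAverage F K)
      (fun b => if b then subgroupAverage F H else 0) fun r hr => by
    have hr0 : r true * subgroupAverage F H + r false * subgroupAverage F K = 0 := by
      rw [Finsupp.linearCombination_apply, Finsupp.sum_fintype _ _ (by simp)] at hr
      simpa using hr
    have : r true * subgroupAverage F H = 0 :=
      eq_zero_of_le_rightStabilizer (K := H ⊔ K) <| by
        refine sup_le (le_rightStabilizer_mul_subgroupAverage _) ?_
        rw [eq_neg_of_add_eq_zero_left hr0, ← neg_mul]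
        exact le_rightStabilizer_mul_subgroupAverage _
    rw [Finsupp.linearCombination_apply, Finsupp.sum_fintype _ _ (by simp)]
    simpa using this
  have h1 := congrArg (augmentation F G) (hc true)
  have h2 := congrArg (augmentation F G) (hc false)
  simp only [if_true, map_mul, augmentation_subgroupAverage, one_mul] at h1
  simp [augmentation_subgroupAverage, h1] at h2

/-- Along an increasing sequence of finite subgroups, the coefficient at `1` of
`subgroupAverage F (H n) * c` is eventually a constant divided by the order of `H n`. -/
theorem eventually_coeff_subgroupAverage_mul {H : ℕ → Subgroup G} [∀ n, Finite (H n)]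
    (hH : Monotone H) (c : MonoidAlgebra F G) :
    ∃ t : F, ∀ᶠ n in Filter.atTop,
      (subgroupAverage F (H n) * c).coeff 1 = t * (Nat.card (H n) : F)⁻¹ := by
  induction c using MonoidAlgebra.induction_linear with
  | zero => exact ⟨0, by simp⟩
  | add x y hx hy =>
    obtain ⟨s, hs⟩ := hx
    obtain ⟨t, ht⟩ := hy
    refine ⟨s + t, ?_⟩
    filter_upwards [hs, ht] with n hn hn'
    rw [mul_add, coeff_add, Finsupp.add_apply, hn, hn', add_mul]
  | single g a =>
    by_cases hg : ∃ N, g ∈ H N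
    · obtain ⟨N, hN⟩ := hg
      refine ⟨a, Filter.eventually_atTop.mpr ⟨N, fun n hn => ?_⟩⟩
      rw [coeff_subgroupAverage_mul_single, if_pos (hH hn hN)]
    · refine ⟨0, Filter.Eventually.of_forall fun n => ?_⟩
      rw [coeff_subgroupAverage_mul_single, if_neg fun h => hg ⟨n, h⟩, zero_mul]

/-- In characteristic zero, a group with a strictly increasing sequence of finite subgroups does
not have an `ℵ₀`-self-injective group algebra. -/
theorem not_aleph0Injective_of_strictMono [CharZero F] {H : ℕ → Subgroup G}
    [∀ n, Finite (H n)] (hH : StrictMono H) :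
    ¬ Aleph0Injective (MonoidAlgebra F G) (MonoidAlgebra F G) := by
  intro hR
  let e : ℕ → MonoidAlgebra F G := fun n => subgroupAverage F (H n)
  let f : ℕ → MonoidAlgebra F G := fun n => e n - e (n + 1)
  have he : ∀ m n, m ≤ n → e m * e n = e n := fun m n h =>
    subgroupAverage_mul_subgroupAverage_of_le (hH.monotone h)
  have he' : ∀ m n, n ≤ m → e m * e n = e m := fun m n h =>
    subgroupAverage_mul_subgroupAverage_of_ge (hH.monotone h)
  have hff : ∀ m n, f m * f n = if m = n then f n else 0 := by
    intro m n
    simp only [f, sub_mul, mul_sub]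
    rcases lt_trichotomy m n with h | h | h
    · rw [if_neg h.ne, he _ _ h.le, he _ _ (by omega), he _ _ (by omega), he _ _ (by omega)]
      simp
    · subst h
      rw [if_pos rfl, he m m le_rfl, he m (m + 1) (by omega), he' (m + 1) m (by omega),
        he (m + 1) (m + 1) le_rfl]
      simp
    · rw [if_neg h.ne', he' _ _ h.le, he' _ _ (by omega), he' _ _ (by omega),
        he' _ _ (by omega)]
      simp
  obtain ⟨c, hc⟩ := hR.exists_mul_eq f (fun n => if Even n then f n else 0) fun r hr => by
    have hterm : ∀ m, r m * f m = 0 := fun m => by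
      have := congrArg (· * f m) hr
      simp only [Finsupp.linearCombination_apply, Finsupp.sum, smul_eq_mul, Finset.sum_mul,
        mul_assoc, hff, zero_mul, mul_ite, mul_zero, Finset.sum_ite_eq'] at this
      by_cases hm : m ∈ r.support
      · rwa [if_pos hm] at this
      · rw [Finsupp.notMem_support_iff.mp hm, zero_mul]
    rw [Finsupp.linearCombination_apply, Finsupp.sum]
    refine Finset.sum_eq_zero fun m _ => ?_
    rw [smul_eq_mul, mul_ite, hterm, mul_zero, ite_self]
  have hcard : ∀ n, (Nat.card (H n) : F)⁻¹ - (Nat.card (H (n + 1)) : F)⁻¹ ≠ 0 := fun n h => by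
    have hlt : H n < H (n + 1) := hH n.lt_succ_self
    have heq : Nat.card (H n) = Nat.card (H (n + 1)) := by
      exact_mod_cast inv_injective (sub_eq_zero.mp h)
    exact hlt.ne (Subgroup.eq_of_le_of_card_ge hlt.le heq.ge)
  have he1 : ∀ n, (e n).coeff 1 = (Nat.card (H n) : F)⁻¹ := fun n => by
    have := coeff_subgroupAverage_mul_single (H := H n) (1 : G) (1 : F)
    rwa [← one_def, mul_one, if_pos (H n).one_mem, one_mul] at this
  obtain ⟨t, ht⟩ := eventually_coeff_subgroupAverage_mul hH.monotone c
  obtain ⟨N, hN⟩ := Filter.eventually_atTop.mp ht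
  have hfc : ∀ n, N ≤ n → (f n * c).coeff 1 = t * (f n).coeff 1 := fun n hn => by
    simp only [f, sub_mul, coeff_sub, Finsupp.sub_apply, he1]
    rw [hN n hn, hN (n + 1) (by omega), mul_sub]
  have hf1 : ∀ n, (f n).coeff 1 ≠ 0 := fun n => by
    simpa only [f, coeff_sub, Finsupp.sub_apply, he1] using hcard n
  have h1 := hfc (2 * N) (by omega)
  have h2 := hfc (2 * N + 1) (by omega)
  rw [hc, if_pos (by simp)] at h1
  rw [hc, if_neg (by simp), coeff_zero, Finsupp.zero_apply] at h2
  have ht0 : t = 0 := (mul_eq_zero.mp h2.symm).resolve_right (hf1 _)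
  rw [ht0, zero_mul] at h1
  exact hf1 _ h1

/-- In characteristic zero, a group with `ℵ₀`-self-injective group algebra is finite. -/
theorem finite_of_aleph0Injective [CharZero F]
    (hR : Aleph0Injective (MonoidAlgebra F G) (MonoidAlgebra F G)) : Finite G := by
  by_contra hG
  let S := {H : Subgroup G // Finite H}
  have : Nonempty S := ⟨⟨⊥, inferInstance⟩⟩
  have : NoMaxOrder S := ⟨fun ⟨H, hH⟩ => by
    obtain ⟨g, hg⟩ : ∃ g, g ∉ H := by
      by_contra! hall
      exact hG (Finite.of_injective (fun g : G => (⟨g, hall g⟩ : H))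
        fun a b hab => congrArg Subtype.val hab)
    have : Finite (Subgroup.zpowers g) :=
      (isOfFinOrder_of_aleph0Injective hR g).finite_zpowers.to_subtype
    exact ⟨⟨H ⊔ Subgroup.zpowers g, finite_sup_of_aleph0Injective hR _ _⟩,
      show H < H ⊔ Subgroup.zpowers g from left_lt_sup.mpr fun h =>
        hg (h (Subgroup.mem_zpowers g))⟩⟩
  obtain ⟨H, hH⟩ := Nat.exists_strictMono S
  have : ∀ n, Finite (H n).1 := fun n => (H n).2
  exact not_aleph0Injective_of_strictMono (F := F) (H := fun n => (H n).1)
    (fun _ _ h => hH h) hR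

end MonoidAlgebra

/-- Let `F` be a field of characteristic `0` and `G` a group.  The following are
equivalent: (1) the group algebra `F[G]` is ℵ₀-self-injective; (2) `G` is finite;
(3) `F[G]` is self-injective (injective as a module over itself). -/
theorem groupAlgebra_aleph0SelfInjective_tfae (F : Type u) [Field F] [CharZero F]
    (G : Type u) [Group G] :
    List.TFAE
      [ Aleph0Injective (MonoidAlgebra F G) (MonoidAlgebra F G),
        Finite G,
        Module.Injective (MonoidAlgebra F G) (MonoidAlgebra F G) ] := by
  tfae_have 1 → 2 := MonoidAlgebra.finite_of_aleph0Injective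
  tfae_have 2 → 3 := fun _ => by
    have : NeZero (Nat.card G : F) := ⟨Nat.cast_ne_zero.mpr Nat.card_pos.ne'⟩
    exact Module.injective_of_isSemisimpleRing _ _
  tfae_have 3 → 1 := fun h I _ f => by
    obtain ⟨g, hg⟩ := Module.Baer.of_injective h I f
    exact ⟨g, fun x => hg x x.2⟩
  tfae_finish
end

section
/- Let M be an R-module that is the internal direct sum of a countably infinite family {M_n | n ∈ ℕ} of nonzero submodules, and let S = End_R(M) be its endomorphism ring, so that M is a left S-module via f • m = f(m). Then M is not an ℵ₀-injective S-module: there exist a countably generated left ideal A of S and an S-linear map f : A → M that does not extend to an S-linear map S → M. -/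
universe u

/-- Summing the values of endomorphisms along a family of vectors, as a map linear over the
endomorphism ring, on a left ideal each of whose members kills almost all of the family. -/
noncomputable def sumEvalOn {R M ι : Type*} [Ring R] [AddCommGroup M] [Module R M] (m : ι → M)
    (I : Ideal (Module.End R M)) (hI : ∀ a ∈ I, (Function.support fun i ↦ a (m i)).Finite) :
    I →ₗ[Module.End R M] M where
  toFun a := ∑ᶠ i, (a : Module.End R M) (m i)
  map_add' a b := finsum_add_distrib (hI a a.2) (hI b b.2)
  map_smul' s a := (AddMonoidHom.map_finsum s.toAddMonoidHom (hI a a.2)).symm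

/-- Every member of the left ideal generated by a family of endomorphisms `e` kills almost all of
a family of vectors which is orthogonal to `e`. -/
theorem finite_support_apply_of_mem_span {R M ι : Type*} [Ring R] [AddCommGroup M] [Module R M]
    {m : ι → M} {e : ι → Module.End R M} (he : ∀ i j, i ≠ j → e i (m j) = 0)
    {a : Module.End R M} (ha : a ∈ Ideal.span (Set.range e)) :
    (Function.support fun i ↦ a (m i)).Finite := by
  induction ha using Submodule.span_induction with
  | mem x hx =>
    obtain ⟨i, rfl⟩ := hx
    refine (Set.finite_singleton i).subset fun j hj ↦ ?_
    by_contra hij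
    exact hj (he i j (Ne.symm hij))
  | zero => simp
  | add x y _ _ hx hy => exact (hx.union hy).subset (Function.support_add _ _)
  | smul s x _ hx =>
    refine hx.subset fun i hi hxi ↦ hi ?_
    change s (x (m i)) = 0
    rw [show x (m i) = 0 from hxi, map_zero]

/-- A module with a countably infinite family of nonzero vectors `m`, and a pointwise almost
everywhere zero family of endomorphisms dual to it, is not ℵ₀-injective over its endomorphism
ring. -/
theorem not_aleph0Injective_end_of_dual_family {R M ι : Type*} [Ring R] [AddCommGroup M]
    [Module R M] [Countable ι] [Infinite ι] {m : ι → M} {e : ι → Module.End R M}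
    (hm : ∀ i, m i ≠ 0) (he_same : ∀ i, e i (m i) = m i) (he : ∀ i j, i ≠ j → e i (m j) = 0)
    (hfin : ∀ x, (Function.support fun i ↦ e i x).Finite) :
    ¬ Aleph0Injective (Module.End R M) M := by
  intro h
  obtain ⟨g, hg⟩ := h _ ⟨_, Set.countable_range e, rfl⟩
    (sumEvalOn m _ fun _ ha ↦ finite_support_apply_of_mem_span he ha)
  have hval (i : ι) : e i (g 1) = m i := by
    calc e i (g 1) = g (e i) := by rw [← Module.End.smul_def, ← map_smul, smul_eq_mul, mul_one]
      _ = ∑ᶠ j, e i (m j) := hg ⟨e i, Ideal.subset_span ⟨i, rfl⟩⟩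
      _ = e i (m i) := finsum_eq_single _ i fun j hj ↦ he i j hj.symm
      _ = m i := he_same i
  refine Set.infinite_univ ((hfin (g 1)).subset fun i _ ↦ ?_)
  rw [Function.mem_support, hval]
  exact hm i

/-- Let `M` be an `R`-module which is the internal direct sum of a countably infinite
family of nonzero submodules, and let `S = End_R(M)` act on `M` by evaluation.  Then `M`
is not an ℵ₀-injective `S`-module. -/
theorem not_aleph0Injective_end_of_internal_directSum (R : Type u) [Ring R]
    (M : Type u) [AddCommGroup M] [Module R M]
    (Mn : ℕ → Submodule R M) (hint : DirectSum.IsInternal Mn) (hne : ∀ n, Mn n ≠ ⊥) :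
    ¬ Aleph0Injective (Module.End R M) M := by
  let E := LinearEquiv.ofBijective (DirectSum.coeLinearMap Mn) hint
  choose m hmem hm using fun n ↦ Submodule.exists_mem_ne_zero_of_ne_bot (hne n)
  refine not_aleph0Injective_end_of_dual_family (m := m)
    (e := fun n ↦ (Mn n).subtype ∘ₗ DirectSum.component R ℕ (fun i ↦ Mn i) n ∘ₗ E.symm.toLinearMap)
    hm (fun n ↦ ?_) (fun i j hij ↦ ?_) fun x ↦ ?_
  · exact congrArg Subtype.val (hint.ofBijective_coeLinearMap_of_mem (hmem n))
  · exact congrArg Subtype.val (hint.ofBijective_coeLinearMap_of_mem_ne hij.symm (hmem j))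
  · classical
    refine (DFinsupp.finite_support (E.symm x)).subset fun i hi h0 ↦ hi ?_
    exact congrArg Subtype.val h0
end
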